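/- arXiv:1407.5559 — 2 statements merged into one kernel-verified Lean document; each statement's English description precedes it below -/
import Mathlib

section
/- Let n ≥ 1, 0 < α < 2, and 0 ≤ γ ≤ 1 with γ < α. Suppose u : ℝⁿ → ℝ is continuous, belongs to L_α, is α-harmonic in the sense of distributions, and satisfies liminf_{|x| → ∞} u(x)/|x|^γ ≥ 0. Then u is constant on ℝⁿ. -/
open MeasureTheory Filter Topology Metric

noncomputable section

/-- Membership in the space `L_α`: `∫ |u(x)|/(1+|x|^{n+α}) dx < ∞` (including measurability). -/
def InLalpha (n : ℕ) (α : ℝ) (u : EuclideanSpace ℝ (Fin n) → ℝ) : Prop :=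
  Integrable (fun x : EuclideanSpace ℝ (Fin n) => u x / (1 + ‖x‖ ^ ((n : ℝ) + α)))

/-- `L` is the principal-value integral `lim_{ε→0⁺} ∫_{|x-z|>ε} (φ(x)-φ(z))/|x-z|^{n+α} dz`,
i.e. `(-Δ)^{α/2} φ (x)` up to the normalizing constant `C_{n,α}`. -/
def IsFracLapAt (n : ℕ) (α : ℝ) (φ : EuclideanSpace ℝ (Fin n) → ℝ)
    (x : EuclideanSpace ℝ (Fin n)) (L : ℝ) : Prop :=
  Tendsto (fun ε : ℝ =>
      ∫ z in {z : EuclideanSpace ℝ (Fin n) | ε < ‖x - z‖},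
        (φ x - φ z) / ‖x - z‖ ^ ((n : ℝ) + α))
    (𝓝[>] 0) (𝓝 L)

/-- `u` is `α`-harmonic in the sense of distributions:
`∫ u(x) (-Δ)^{α/2}φ(x) dx = 0` for every `φ ∈ C_c^∞(ℝⁿ)`.  (The positive normalizing
constant `C_{n,α}` is irrelevant to the vanishing of the integral.) -/
def AlphaHarmonic (n : ℕ) (α : ℝ) (u : EuclideanSpace ℝ (Fin n) → ℝ) : Prop :=
  ∀ φ : EuclideanSpace ℝ (Fin n) → ℝ, ContDiff ℝ (⊤ : ℕ∞) φ → HasCompactSupport φ →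
    ∀ g : EuclideanSpace ℝ (Fin n) → ℝ,
      (∀ x, IsFracLapAt n α φ x (g x)) → ∫ x, u x * g x = 0

/-- The fractional Laplacian, up to the normalizing constant, in its symmetrized form. -/
def symLap {n : ℕ} (α : ℝ) (φ : EuclideanSpace ℝ (Fin n) → ℝ) (x : EuclideanSpace ℝ (Fin n)) : ℝ :=
  (1 / 2) * ∫ z, (2 * φ x - φ (x + z) - φ (x - z)) / ‖z‖ ^ ((n : ℝ) + α)

lemma exists_norm_second_difference_le {E F : Type*} [NormedAddCommGroup E] [NormedSpace ℝ E]
    [NormedAddCommGroup F] [NormedSpace ℝ F] {f : E → F} (hf : ContDiff ℝ 2 f)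
    (hc : HasCompactSupport f) :
    ∃ M : ℝ, 0 ≤ M ∧ ∀ x z, ‖(2 : ℝ) • f x - f (x + z) - f (x - z)‖ ≤ M * min (‖z‖ ^ 2) 1 := by
  obtain ⟨K, hK⟩ : ∃ K, LipschitzWith K (fderiv ℝ f) :=
    ⟨_, ((hf.fderiv_right (m := 1) (by norm_num)).lipschitzWith_of_hasCompactSupport
      (hc.fderiv ℝ) (by norm_num)).choose_spec⟩
  obtain ⟨B, hB⟩ := hf.continuous.bounded_above_of_compact_support hc
  have hB0 : 0 ≤ B := (norm_nonneg _).trans (hB 0)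
  refine ⟨max (2 * K) (4 * B), by positivity, fun x z => ?_⟩
  have h1 : ‖(2 : ℝ) • f x - f (x + z) - f (x - z)‖ ≤ (2 * K) * ‖z‖ ^ 2 := by
    have hd : ∀ w : E, HasFDerivAt (fun w => f (x + w) + f (x - w))
        (fderiv ℝ f (x + w) - fderiv ℝ f (x - w)) w := by
      intro w
      have hdf : ∀ y, HasFDerivAt f (fderiv ℝ f y) y := fun y =>
        (hf.differentiable (by norm_num) y).hasFDerivAt
      have ha := (hdf (x + w)).comp w ((hasFDerivAt_id w).const_add x)
      have hb := (hdf (x - w)).comp w ((hasFDerivAt_id w).const_sub x)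
      refine (ha.add hb).congr_fderiv ?_
      ext v; simp [sub_eq_add_neg]
    have := (convex_closedBall (0 : E) ‖z‖).norm_image_sub_le_of_norm_hasFDerivWithin_le
      (C := 2 * K * ‖z‖) (fun w _ => (hd w).hasFDerivWithinAt) (fun w hw => ?_)
      (x := 0) (y := z) (by simp) (by simp)
    · calc _ = ‖f (x + z) + f (x - z) - (f (x + 0) + f (x - 0))‖ := by
            rw [← norm_neg]; congr 1; simp [two_smul]; abel
        _ ≤ _ := this
        _ = _ := by simp; ring
    · have h2 := hK.dist_le_mul (x + w) (x - w)
      rw [dist_eq_norm, dist_eq_norm] at h2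
      have h3 : ‖x + w - (x - w)‖ ≤ 2 * ‖z‖ := by
        have : x + w - (x - w) = (2 : ℝ) • w := by rw [two_smul]; abel
        rw [this, norm_smul]
        have : ‖w‖ ≤ ‖z‖ := by simpa using hw
        norm_num; linarith
      calc _ ≤ _ := h2
        _ ≤ K * (2 * ‖z‖) := by gcongr
        _ = _ := by ring
  have h2 : ‖(2 : ℝ) • f x - f (x + z) - f (x - z)‖ ≤ 4 * B := by
    have a1 := norm_sub_le ((2 : ℝ) • f x - f (x + z)) (f (x - z))
    have a2 := norm_sub_le ((2 : ℝ) • f x) (f (x + z))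
    have a3 : ‖(2 : ℝ) • f x‖ = 2 * ‖f x‖ := by rw [norm_smul]; norm_num
    linarith [hB x, hB (x + z), hB (x - z)]
  rcases le_total (‖z‖ ^ 2) 1 with h | h
  · rw [min_eq_left h]
    exact h1.trans (by gcongr; exact le_max_left _ _)
  · rw [min_eq_right h, mul_one]
    exact h2.trans (le_max_right _ _)

lemma integrable_min_div_rpow {n : ℕ} [NeZero n] {α : ℝ} (hα0 : 0 < α) (hα2 : α < 2) :
    Integrable (fun z : EuclideanSpace ℝ (Fin n) => min (‖z‖ ^ 2) 1 / ‖z‖ ^ ((n : ℝ) + α)) := by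
  have hn : 1 ≤ n := NeZero.one_le
  rw [integrable_fun_norm_addHaar volume (f := fun r : ℝ => min (r ^ 2) 1 / r ^ ((n : ℝ) + α))]
  have hpow : ∀ r : ℝ, 0 < r → r ^ (n - 1) / r ^ ((n : ℝ) + α) = r ^ (-1 - α) := by
    intro r hr
    rw [← Real.rpow_natCast, ← Real.rpow_sub hr]
    congr 1
    push_cast [hn]; ring
  rw [← Set.Ioc_union_Ioi_eq_Ioi (zero_le_one' ℝ)]
  refine IntegrableOn.union ?_ ?_
  · have : IntegrableOn (fun r : ℝ => r ^ (1 - α)) (Set.Ioc 0 1) := by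
      rw [← intervalIntegrable_iff_integrableOn_Ioc_of_le zero_le_one]
      exact intervalIntegral.intervalIntegrable_rpow' (by linarith)
    refine this.congr_fun (fun r hr => ?_) measurableSet_Ioc
    have h1 : r ^ 2 ≤ 1 := by nlinarith [hr.1, hr.2]
    simp only [finrank_euclideanSpace_fin, smul_eq_mul, min_eq_left h1]
    rw [mul_div_assoc', mul_comm, mul_div_assoc, hpow r hr.1, ← Real.rpow_natCast,
      ← Real.rpow_add hr.1]
    congr 1; push_cast; ring
  · have : IntegrableOn (fun r : ℝ => r ^ (-1 - α)) (Set.Ioi 1) :=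
      integrableOn_Ioi_rpow_of_lt (by linarith) one_pos
    refine this.congr_fun (fun r hr => ?_) measurableSet_Ioi
    have hr : 1 < r := hr
    have h1 : 1 ≤ r ^ 2 := by nlinarith
    simp only [finrank_euclideanSpace_fin, smul_eq_mul, min_eq_right h1]
    rw [mul_one_div, hpow r (by linarith)]

lemma integrable_symLap_integrand {n : ℕ} [NeZero n] {α : ℝ} (hα0 : 0 < α) (hα2 : α < 2)
    {F : Type*} [NormedAddCommGroup F] [NormedSpace ℝ F] {M : ℝ}
    {f : EuclideanSpace ℝ (Fin n) → F} (hf : Continuous f) (x : EuclideanSpace ℝ (Fin n))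
    (hM : ∀ x z, ‖(2 : ℝ) • f x - f (x + z) - f (x - z)‖ ≤ M * min (‖z‖ ^ 2) 1) :
    Integrable (fun z => (‖z‖ ^ ((n : ℝ) + α))⁻¹ • ((2 : ℝ) • f x - f (x + z) - f (x - z))) := by
  refine ((integrable_min_div_rpow hα0 hα2).const_mul M).mono' ?_ (.of_forall fun z => ?_)
  · have hn : (0 : ℝ) ≤ n + α := by positivity
    refine AEStronglyMeasurable.smul ?_ ?_
    · exact (by fun_prop : Measurable fun z : EuclideanSpace ℝ (Fin n) =>
        (‖z‖ ^ ((n : ℝ) + α))⁻¹).aestronglyMeasurable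
    · exact (by fun_prop : Continuous fun z => (2 : ℝ) • f x - f (x + z) - f (x - z)).aestronglyMeasurable
  · rw [norm_smul, norm_inv, Real.norm_of_nonneg (by positivity), mul_div_assoc', div_eq_inv_mul]
    gcongr
    exact hM x z

/-- The kernel `‖z‖⁻ⁿ⁻ᵅ` truncated away from the origin. -/
def truncKernel {n : ℕ} (α ε : ℝ) (z : EuclideanSpace ℝ (Fin n)) : ℝ :=
  {z | ε < ‖z‖}.indicator (fun z => 1 / ‖z‖ ^ ((n : ℝ) + α)) z

lemma truncKernel_nonneg {n : ℕ} (α ε : ℝ) (z : EuclideanSpace ℝ (Fin n)) :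
    0 ≤ truncKernel α ε z := Set.indicator_nonneg (fun _ _ => by positivity) _

lemma truncKernel_le {n : ℕ} (α ε : ℝ) (z : EuclideanSpace ℝ (Fin n)) :
    truncKernel α ε z ≤ 1 / ‖z‖ ^ ((n : ℝ) + α) :=
  Set.indicator_le_self' (fun _ _ => by positivity) _

lemma truncKernel_neg {n : ℕ} (α ε : ℝ) (z : EuclideanSpace ℝ (Fin n)) :
    truncKernel α ε (-z) = truncKernel α ε z := by simp [truncKernel, Set.indicator]

lemma measurable_truncKernel {n : ℕ} (α ε : ℝ) :
    Measurable (truncKernel (n := n) α ε) := by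
  unfold truncKernel
  exact Measurable.indicator (by fun_prop) (measurableSet_lt measurable_const measurable_norm)

lemma integrable_truncKernel {n : ℕ} [NeZero n] {α ε : ℝ} (hα0 : 0 < α) (hα2 : α < 2) (hε : 0 < ε) :
    Integrable (truncKernel (n := n) α ε) := by
  refine ((integrable_min_div_rpow hα0 hα2).const_mul (max 1 (1 / ε ^ 2))).mono'
    (measurable_truncKernel α ε).aestronglyMeasurable (.of_forall fun z => ?_)
  rw [Real.norm_of_nonneg (truncKernel_nonneg _ _ _)]
  unfold truncKernel
  refine Set.indicator_apply_le' (fun h => ?_) fun _ => by positivity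
  have h : ε < ‖z‖ := h
  rw [mul_div_assoc']
  gcongr
  rcases le_total (‖z‖ ^ 2) 1 with h1 | h1
  · rw [min_eq_left h1]
    calc (1 : ℝ) = 1 / ε ^ 2 * ε ^ 2 := by field_simp
      _ ≤ _ := by gcongr; exact le_max_right _ _
  · rw [min_eq_right h1, mul_one]; exact le_max_left _ _

/-- The truncated (non-symmetrized) singular integral. -/
def truncLap {n : ℕ} (α ε : ℝ) (φ : EuclideanSpace ℝ (Fin n) → ℝ)
    (x : EuclideanSpace ℝ (Fin n)) : ℝ :=
  ∫ w, (φ x - φ (x + w)) * truncKernel α ε w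

section truncLap

variable {n : ℕ} {α : ℝ} {φ : EuclideanSpace ℝ (Fin n) → ℝ} {B M : ℝ}

lemma setIntegral_eq_truncLap (ε : ℝ) (x : EuclideanSpace ℝ (Fin n)) :
    ∫ z in {z : EuclideanSpace ℝ (Fin n) | ε < ‖x - z‖}, (φ x - φ z) / ‖x - z‖ ^ ((n : ℝ) + α)
      = truncLap α ε φ x := by
  have hs : MeasurableSet {z : EuclideanSpace ℝ (Fin n) | ε < ‖x - z‖} :=
    measurableSet_lt measurable_const (by fun_prop)
  rw [← integral_indicator hs, truncLap, ← integral_add_left_eq_self _ x]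
  refine integral_congr_ae (.of_forall fun w => ?_)
  by_cases h : ε < ‖w‖ <;> simp [truncKernel, Set.indicator, h, div_eq_mul_inv]

lemma integrable_sub_mul_truncKernel [NeZero n] (hα0 : 0 < α) (hα2 : α < 2) (hφ : Continuous φ)
    (hB : ∀ x, |φ x| ≤ B) {ε : ℝ} (hε : 0 < ε) (x : EuclideanSpace ℝ (Fin n)) :
    Integrable (fun w => (φ x - φ (x + w)) * truncKernel α ε w) := by
  refine (integrable_truncKernel hα0 hα2 hε).bdd_mul (c := 2 * B)
    (by fun_prop : Continuous fun w => φ x - φ (x + w)).aestronglyMeasurable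
    (.of_forall fun w => ?_)
  have := norm_sub_le (φ x) (φ (x + w))
  simp only [Real.norm_eq_abs] at *
  linarith [hB x, hB (x + w)]

lemma truncLap_eq [NeZero n] (hα0 : 0 < α) (hα2 : α < 2) (hφ : Continuous φ)
    (hB : ∀ x, |φ x| ≤ B) {ε : ℝ} (hε : 0 < ε) (x : EuclideanSpace ℝ (Fin n)) :
    truncLap α ε φ x
      = (1 / 2) * ∫ w, (2 * φ x - φ (x + w) - φ (x - w)) * truncKernel α ε w := by
  have h1 := integrable_sub_mul_truncKernel hα0 hα2 hφ hB hε x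
  have h2 := h1.comp_neg
  have h3 : truncLap α ε φ x = ∫ w, (φ x - φ (x + -w)) * truncKernel α ε (-w) := by
    rw [truncLap]
    exact (integral_neg_eq_self (fun w => (φ x - φ (x + w)) * truncKernel α ε w) volume).symm
  have h4 : truncLap α ε φ x + truncLap α ε φ x =
      ∫ w, (2 * φ x - φ (x + w) - φ (x - w)) * truncKernel α ε w := by
    nth_rw 2 [h3]
    rw [truncLap, ← integral_add h1 h2]
    refine integral_congr_ae (.of_forall fun w => ?_)
    simp only [truncKernel_neg, ← sub_eq_add_neg]
    ring
  linarith

lemma abs_second_difference_mul_truncKernel_le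
    (hM : ∀ x z, ‖(2 : ℝ) • φ x - φ (x + z) - φ (x - z)‖ ≤ M * min (‖z‖ ^ 2) 1) (ε : ℝ)
    (x w : EuclideanSpace ℝ (Fin n)) :
    |(2 * φ x - φ (x + w) - φ (x - w)) * truncKernel α ε w|
      ≤ M * (min (‖w‖ ^ 2) 1 / ‖w‖ ^ ((n : ℝ) + α)) := by
  rw [abs_mul, abs_of_nonneg (truncKernel_nonneg α ε w)]
  have := hM x w
  rw [smul_eq_mul, Real.norm_eq_abs] at this
  calc _ ≤ (M * min (‖w‖ ^ 2) 1) * (1 / ‖w‖ ^ ((n : ℝ) + α)) := by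
        gcongr
        · exact truncKernel_nonneg α ε w
        · exact (abs_nonneg _).trans this
        · exact truncKernel_le α ε w
    _ = _ := by ring

lemma abs_truncLap_le [NeZero n] (hα0 : 0 < α) (hα2 : α < 2) (hφ : Continuous φ) (hB : ∀ x, |φ x| ≤ B)
    (hM : ∀ x z, ‖(2 : ℝ) • φ x - φ (x + z) - φ (x - z)‖ ≤ M * min (‖z‖ ^ 2) 1)
    {ε : ℝ} (hε : 0 < ε) (x : EuclideanSpace ℝ (Fin n)) :
    |truncLap α ε φ x| ≤ (1 / 2) * ∫ w : EuclideanSpace ℝ (Fin n),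
      M * (min (‖w‖ ^ 2) 1 / ‖w‖ ^ ((n : ℝ) + α)) := by
  rw [truncLap_eq hα0 hα2 hφ hB hε, abs_mul, abs_of_pos one_half_pos]
  gcongr
  rw [← Real.norm_eq_abs]
  exact norm_integral_le_of_norm_le ((integrable_min_div_rpow hα0 hα2).const_mul M)
    (.of_forall fun w => abs_second_difference_mul_truncKernel_le hM ε x w)

lemma tendsto_truncLap [NeZero n] (hα0 : 0 < α) (hα2 : α < 2) (hφ : Continuous φ) (hB : ∀ x, |φ x| ≤ B)
    (hM : ∀ x z, ‖(2 : ℝ) • φ x - φ (x + z) - φ (x - z)‖ ≤ M * min (‖z‖ ^ 2) 1)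
    (x : EuclideanSpace ℝ (Fin n)) :
    Tendsto (fun ε => truncLap α ε φ x) (𝓝[>] 0) (𝓝 (symLap α φ x)) := by
  have h : Tendsto (fun ε => (1 / 2) *
      ∫ w, (2 * φ x - φ (x + w) - φ (x - w)) * truncKernel α ε w) (𝓝[>] 0)
      (𝓝 (symLap α φ x)) := by
    refine Tendsto.const_mul _ ?_
    refine tendsto_integral_filter_of_dominated_convergence
      (fun w => M * (min (‖w‖ ^ 2) 1 / ‖w‖ ^ ((n : ℝ) + α))) ?_ ?_
      ((integrable_min_div_rpow hα0 hα2).const_mul M) ?_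
    · refine .of_forall fun ε => ?_
      exact (by fun_prop : Continuous fun w => 2 * φ x - φ (x + w) - φ (x - w)).aestronglyMeasurable.mul
        (measurable_truncKernel α ε).aestronglyMeasurable
    · exact .of_forall fun ε => .of_forall fun w =>
        abs_second_difference_mul_truncKernel_le hM ε x w
    · refine .of_forall fun w => ?_
      refine tendsto_const_nhds.congr' ?_
      rcases eq_or_ne w 0 with rfl | hw
      · filter_upwards with ε
        simp [two_mul]
      · have : ∀ᶠ ε in 𝓝[>] (0 : ℝ), ε < ‖w‖ :=
          nhdsWithin_le_nhds (eventually_lt_nhds (norm_pos_iff.2 hw))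
        filter_upwards [this] with ε hε
        simp [truncKernel, Set.indicator, hε, div_eq_mul_inv]
  refine h.congr' ?_
  filter_upwards [self_mem_nhdsWithin] with ε hε
  exact (truncLap_eq hα0 hα2 hφ hB hε x).symm

lemma isFracLapAt_symLap [NeZero n] (hα0 : 0 < α) (hα2 : α < 2) (hφ : ContDiff ℝ (⊤ : ℕ∞) φ)
    (hc : HasCompactSupport φ) (x : EuclideanSpace ℝ (Fin n)) :
    IsFracLapAt n α φ x (symLap α φ x) := by
  obtain ⟨M, -, hM⟩ := exists_norm_second_difference_le (hφ.of_le ENat.LEInfty.out) hc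
  obtain ⟨B, hB⟩ := hφ.continuous.bounded_above_of_compact_support hc
  refine (tendsto_truncLap hα0 hα2 hφ.continuous hB hM x).congr fun ε => ?_
  exact (setIntegral_eq_truncLap ε x).symm

lemma symLap_comp_dilation {s : ℝ} (hs : 0 < s) (x₀ x : EuclideanSpace ℝ (Fin n)) :
    symLap α (fun y => φ (s⁻¹ • (x₀ - y))) x = s ^ (-α) * symLap α φ (s⁻¹ • (x₀ - x)) := by
  have h := Measure.integral_comp_smul (volume : Measure (EuclideanSpace ℝ (Fin n)))
    (fun z => (2 * φ (s⁻¹ • (x₀ - x)) - φ (s⁻¹ • (x₀ - x) + z) - φ (s⁻¹ • (x₀ - x) - z))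
      / ‖z‖ ^ ((n : ℝ) + α)) s⁻¹
  have e : ∀ z : EuclideanSpace ℝ (Fin n), (2 * φ (s⁻¹ • (x₀ - x)) -
      φ (s⁻¹ • (x₀ - (x + z))) - φ (s⁻¹ • (x₀ - (x - z)))) / ‖z‖ ^ ((n : ℝ) + α) =
      s ^ (-((n : ℝ) + α)) * ((2 * φ (s⁻¹ • (x₀ - x)) - φ (s⁻¹ • (x₀ - x) + s⁻¹ • z)
        - φ (s⁻¹ • (x₀ - x) - s⁻¹ • z)) / ‖s⁻¹ • z‖ ^ ((n : ℝ) + α)) := by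
    intro z
    have e1 : s⁻¹ • (x₀ - (x + z)) = s⁻¹ • (x₀ - x) - s⁻¹ • z := by
      rw [← smul_sub]; congr 1; abel
    have e2 : s⁻¹ • (x₀ - (x - z)) = s⁻¹ • (x₀ - x) + s⁻¹ • z := by
      rw [← smul_add]; congr 1; abel
    rw [e1, e2, norm_smul, norm_inv, Real.norm_of_nonneg hs.le,
      Real.mul_rpow (by positivity) (by positivity), Real.inv_rpow hs.le, Real.rpow_neg hs.le]
    have : s ^ ((n : ℝ) + α) ≠ 0 := by positivity
    rcases eq_or_ne (‖z‖ ^ ((n : ℝ) + α)) 0 with h0 | h0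
    · simp [h0]
    · field_simp
      ring
  rw [symLap, symLap, integral_congr_ae (.of_forall e), integral_const_mul, h]
  have : |((s⁻¹ ^ n)⁻¹ : ℝ)| = s ^ (n : ℝ) := by
    rw [Real.rpow_natCast, inv_pow, inv_inv, abs_of_pos (by positivity)]
  rw [finrank_euclideanSpace_fin, this, smul_eq_mul]
  have : s ^ (-α) = s ^ (-((n : ℝ) + α)) * s ^ (n : ℝ) := by
    rw [← Real.rpow_add hs]; congr 1; ring
  rw [this]; ring

lemma integral_mul_symLap_dilation [NeZero n] (hα0 : 0 < α) (hα2 : α < 2) (hφ : ContDiff ℝ (⊤ : ℕ∞) φ)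
    (hc : HasCompactSupport φ) {u : EuclideanSpace ℝ (Fin n) → ℝ} (hu : AlphaHarmonic n α u)
    {s : ℝ} (hs : 0 < s) (x₀ : EuclideanSpace ℝ (Fin n)) :
    ∫ x, u x * symLap α φ (s⁻¹ • (x₀ - x)) = 0 := by
  have h1 : ContDiff ℝ (⊤ : ℕ∞) fun y => φ (s⁻¹ • (x₀ - y)) :=
    hφ.comp ((contDiff_const.sub contDiff_id).const_smul s⁻¹)
  have h2 : HasCompactSupport fun y => φ (s⁻¹ • (x₀ - y)) :=
    hc.comp_homeomorph ((Homeomorph.subLeft x₀).trans (Homeomorph.smulOfNeZero s⁻¹ (by positivity)))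
  have h := hu _ h1 h2 _ (isFracLapAt_symLap hα0 hα2 h1 h2)
  simp only [symLap_comp_dilation hs, mul_left_comm _ (s ^ (-α))] at h
  rw [integral_const_mul] at h
  exact (mul_eq_zero.1 h).resolve_left (by positivity)

lemma symLap_eq_of_norm_eq (hφ : ∀ x y, ‖x‖ = ‖y‖ → φ x = φ y)
    {x y : EuclideanSpace ℝ (Fin n)} (hxy : ‖x‖ = ‖y‖) : symLap α φ x = symLap α φ y := by
  obtain ⟨ρ, hρ⟩ : ∃ ρ : EuclideanSpace ℝ (Fin n) ≃ₗᵢ[ℝ] EuclideanSpace ℝ (Fin n), ρ x = y :=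
    ⟨_, Submodule.reflection_sub hxy⟩
  rw [symLap, symLap, ← ρ.measurePreserving.integral_comp ρ.toHomeomorph.measurableEmbedding
    (fun z => (2 * φ y - φ (y + z) - φ (y - z)) / ‖z‖ ^ ((n : ℝ) + α))]
  congr 1
  refine integral_congr_ae (.of_forall fun z => ?_)
  have e0 : φ x = φ y := hφ _ _ hxy
  have e1 : φ (x + z) = φ (y + ρ z) := hφ _ _ (by rw [← hρ, ← map_add, ρ.norm_map])
  have e2 : φ (x - z) = φ (y - ρ z) := hφ _ _ (by rw [← hρ, ← map_sub, ρ.norm_map])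
  simp only [e0, e1, e2, ρ.norm_map]

lemma exists_lipschitz_symLap [NeZero n] (hα0 : 0 < α) (hα2 : α < 2) (hφ : ContDiff ℝ (⊤ : ℕ∞) φ)
    (hc : HasCompactSupport φ) :
    ∃ C : ℝ, 0 ≤ C ∧ ∀ x y, |symLap α φ x - symLap α φ y| ≤ C * ‖x - y‖ := by
  obtain ⟨M, hM0, hM⟩ := exists_norm_second_difference_le (hφ.of_le ENat.LEInfty.out) hc
  obtain ⟨N, hN0, hN⟩ := exists_norm_second_difference_le (f := fderiv ℝ φ)
    ((hφ.fderiv_right (m := (⊤ : ℕ∞)) (by simp)).of_le ENat.LEInfty.out) (hc.fderiv ℝ)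
  have hint := fun x => integrable_symLap_integrand hα0 hα2 hφ.continuous x hM
  have hd : ∀ y, HasFDerivAt φ (fderiv ℝ φ y) y := fun y =>
    (hφ.differentiable (by simp) y).hasFDerivAt
  have hlip : ∀ z x y, |(2 * φ x - φ (x + z) - φ (x - z)) - (2 * φ y - φ (y + z) - φ (y - z))|
      ≤ N * min (‖z‖ ^ 2) 1 * ‖x - y‖ := by
    intro z x y
    refine convex_univ.norm_image_sub_le_of_norm_hasFDerivWithin_le
      (f := fun x => 2 * φ x - φ (x + z) - φ (x - z))
      (f' := fun x => (2 : ℝ) • fderiv ℝ φ x - fderiv ℝ φ (x + z) - fderiv ℝ φ (x - z))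
      (fun w _ => HasFDerivAt.hasFDerivWithinAt ?_) (fun w _ => hN w z) (Set.mem_univ _)
      (Set.mem_univ _)
    have ha := (hd (w + z)).comp w ((hasFDerivAt_id w).add_const z)
    have hb := (hd (w - z)).comp w ((hasFDerivAt_id w).sub_const z)
    exact (((hd w).const_mul 2).sub ha).sub hb
  refine ⟨(1 / 2) * ∫ z : EuclideanSpace ℝ (Fin n),
    N * (min (‖z‖ ^ 2) 1 / ‖z‖ ^ ((n : ℝ) + α)), ?_, fun x y => ?_⟩
  · have : ∀ z : EuclideanSpace ℝ (Fin n),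
        0 ≤ N * (min (‖z‖ ^ 2) 1 / ‖z‖ ^ ((n : ℝ) + α)) := fun z => by positivity
    have := integral_nonneg (μ := volume) (Pi.le_def.2 this)
    positivity
  · have e : ∀ x, symLap α φ x = (1 / 2) * ∫ z, (‖z‖ ^ ((n : ℝ) + α))⁻¹ •
        ((2 : ℝ) • φ x - φ (x + z) - φ (x - z)) := fun x => by
      rw [symLap]; congr 1
      refine integral_congr_ae (.of_forall fun z => ?_)
      simp only [smul_eq_mul]; ring
    rw [e x, e y, ← mul_sub, ← integral_sub (hint x) (hint y), abs_mul, abs_of_pos one_half_pos,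
      mul_assoc, ← integral_mul_const]
    gcongr
    rw [← Real.norm_eq_abs]
    refine norm_integral_le_of_norm_le
      (((integrable_min_div_rpow hα0 hα2).const_mul N).mul_const _) (.of_forall fun z => ?_)
    rw [← smul_sub, norm_smul, norm_inv, Real.norm_of_nonneg (by positivity)]
    calc _ ≤ (‖z‖ ^ ((n : ℝ) + α))⁻¹ * (N * min (‖z‖ ^ 2) 1 * ‖x - y‖) := by
          gcongr; exact hlip z x y
      _ = _ := by ring

end truncLap

/-- A smooth, radially decreasing bump function, equal to `1` on the unit ball and supported in
the ball of radius `2`. -/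
def radialBump {n : ℕ} (x : EuclideanSpace ℝ (Fin n)) : ℝ := Real.smoothTransition (2 - ‖x‖ ^ 2)

section radialBump

variable {n : ℕ} {α : ℝ}

lemma contDiff_radialBump : ContDiff ℝ (⊤ : ℕ∞) (radialBump (n := n)) :=
  Real.smoothTransition.contDiff.comp (contDiff_const.sub (contDiff_norm_sq ℝ))

lemma radialBump_nonneg (x : EuclideanSpace ℝ (Fin n)) : 0 ≤ radialBump x :=
  Real.smoothTransition.nonneg _

lemma radialBump_le_one (x : EuclideanSpace ℝ (Fin n)) : radialBump x ≤ 1 :=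
  Real.smoothTransition.le_one _

lemma abs_radialBump_le_one (x : EuclideanSpace ℝ (Fin n)) : |radialBump x| ≤ 1 := by
  rw [abs_of_nonneg (radialBump_nonneg x)]; exact radialBump_le_one x

lemma radialBump_eq_one {x : EuclideanSpace ℝ (Fin n)} (hx : ‖x‖ ≤ 1) : radialBump x = 1 :=
  Real.smoothTransition.one_of_one_le (by nlinarith [norm_nonneg x])

lemma radialBump_eq_zero {x : EuclideanSpace ℝ (Fin n)} (hx : 2 ≤ ‖x‖) : radialBump x = 0 :=
  Real.smoothTransition.zero_of_nonpos (by nlinarith)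

lemma radialBump_le_of_norm_le {x y : EuclideanSpace ℝ (Fin n)} (h : ‖x‖ ≤ ‖y‖) :
    radialBump y ≤ radialBump x :=
  Real.smoothTransition.monotone (by gcongr)

lemma hasCompactSupport_radialBump : HasCompactSupport (radialBump (n := n)) := by
  refine HasCompactSupport.intro (isCompact_closedBall 0 2) fun x hx => radialBump_eq_zero ?_
  simp only [mem_closedBall, dist_zero_right, not_le] at hx
  exact hx.le

lemma exists_second_difference_radialBump_le :
    ∃ M : ℝ, 0 ≤ M ∧ ∀ x z : EuclideanSpace ℝ (Fin n),
      ‖(2 : ℝ) • radialBump x - radialBump (x + z) - radialBump (x - z)‖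
        ≤ M * min (‖z‖ ^ 2) 1 :=
  exists_norm_second_difference_le (contDiff_radialBump.of_le ENat.LEInfty.out)
    hasCompactSupport_radialBump

lemma exists_truncLap_radialBump_le [NeZero n] (hα0 : 0 < α) (hα2 : α < 2) :
    ∃ D : ℝ, 0 < D ∧ (∀ ε > 0, ∀ x : EuclideanSpace ℝ (Fin n), |truncLap α ε radialBump x| ≤ D) ∧
      ∀ x : EuclideanSpace ℝ (Fin n), |symLap α radialBump x| ≤ D := by
  obtain ⟨M, -, hM⟩ := exists_second_difference_radialBump_le (n := n)
  obtain ⟨D, hD⟩ : ∃ D, D = (1 / 2) * ∫ w : EuclideanSpace ℝ (Fin n),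
      M * (min (‖w‖ ^ 2) 1 / ‖w‖ ^ ((n : ℝ) + α)) := ⟨_, rfl⟩
  have h : ∀ ε > 0, ∀ x : EuclideanSpace ℝ (Fin n), |truncLap α ε radialBump x| ≤ D + 1 :=
    fun ε hε x => (hD ▸ abs_truncLap_le hα0 hα2 contDiff_radialBump.continuous
      abs_radialBump_le_one hM hε x : _ ≤ D).trans (by linarith)
  refine ⟨D + 1, ?_, h, fun x => ?_⟩
  · have := (abs_nonneg _).trans (hD ▸ abs_truncLap_le hα0 hα2 contDiff_radialBump.continuous
      abs_radialBump_le_one hM one_pos 0 : _ ≤ D)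
    linarith
  · refine le_of_tendsto (tendsto_truncLap hα0 hα2 contDiff_radialBump.continuous
      abs_radialBump_le_one hM x).abs ?_
    filter_upwards [self_mem_nhdsWithin] with ε hε using h ε hε x

lemma exists_symLap_radialBump_decay [NeZero n] (hα0 : 0 < α) (hα2 : α < 2) :
    ∃ C : ℝ, 0 < C ∧ ∀ x : EuclideanSpace ℝ (Fin n),
      |symLap α radialBump x| ≤ C * (1 + ‖x‖) ^ (-((n : ℝ) + α)) := by
  obtain ⟨D, hD0, -, hD⟩ := exists_truncLap_radialBump_le (n := n) hα0 hα2
  have hβ : 0 < (n : ℝ) + α := by positivity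
  set V := volume.real (ball (0 : EuclideanSpace ℝ (Fin n)) 2) with hV
  refine ⟨max (D * 5 ^ ((n : ℝ) + α)) (V * 4 ^ ((n : ℝ) + α)),
    lt_max_of_lt_left (by positivity), fun x => ?_⟩
  rw [Real.rpow_neg (by positivity), ← div_eq_mul_inv]
  rcases lt_or_ge ‖x‖ 4 with hx | hx
  · refine (hD x).trans ?_
    rw [le_div_iff₀ (by positivity)]
    refine le_trans ?_ (le_max_left _ _)
    gcongr
    linarith
  · have hk : ∀ z : EuclideanSpace ℝ (Fin n), ‖x‖ - 2 ≤ ‖z‖ →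
        (‖z‖ ^ ((n : ℝ) + α))⁻¹ ≤ 4 ^ ((n : ℝ) + α) / (1 + ‖x‖) ^ ((n : ℝ) + α) := by
      intro z hz
      rw [← Real.div_rpow (by positivity) (by positivity), ← inv_div, Real.inv_rpow (by positivity)]
      gcongr
      linarith
    set c := 4 ^ ((n : ℝ) + α) / (1 + ‖x‖) ^ ((n : ℝ) + α) with hc
    have hc0 : 0 ≤ c := by positivity
    have hprod : ∀ y z : EuclideanSpace ℝ (Fin n), ‖x‖ - ‖y‖ ≤ ‖z‖ →
        radialBump y / ‖z‖ ^ ((n : ℝ) + α) ≤ c * (ball 0 2).indicator 1 y := by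
      intro y z hyz
      by_cases hy : y ∈ ball (0 : EuclideanSpace ℝ (Fin n)) 2
      · simp only [hy, Set.indicator_of_mem, Pi.one_apply, mul_one]
        rw [div_eq_mul_inv, ← one_mul c]
        have : ‖y‖ < 2 := by simpa using hy
        gcongr
        · exact radialBump_le_one y
        · exact hk z (by linarith)
      · rw [Set.indicator_of_notMem hy, radialBump_eq_zero (by simpa using hy)]; simp
    have hI : Integrable ((ball (0 : EuclideanSpace ℝ (Fin n)) 2).indicator (1 : EuclideanSpace ℝ (Fin n) → ℝ)) := by
      rw [integrable_indicator_iff measurableSet_ball]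
      exact integrableOn_const (by finiteness) (by simp)
    have hIV : ∫ y, (ball (0 : EuclideanSpace ℝ (Fin n)) 2).indicator (1 : EuclideanSpace ℝ (Fin n) → ℝ) y = V :=
      integral_indicator_one measurableSet_ball
    have hI1 : Integrable fun z =>
        (ball (0 : EuclideanSpace ℝ (Fin n)) 2).indicator (1 : EuclideanSpace ℝ (Fin n) → ℝ) (x + z) := hI.comp_add_left x
    have hI2 : Integrable fun z =>
        (ball (0 : EuclideanSpace ℝ (Fin n)) 2).indicator (1 : EuclideanSpace ℝ (Fin n) → ℝ) (x - z) := hI.comp_sub_left x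
    have hbd : |∫ z, (2 * radialBump x - radialBump (x + z) - radialBump (x - z))
        / ‖z‖ ^ ((n : ℝ) + α)| ≤ ∫ z, c * ((ball (0 : EuclideanSpace ℝ (Fin n)) 2).indicator 1 (x + z)
          + (ball 0 2).indicator 1 (x - z)) := by
      rw [← Real.norm_eq_abs]
      refine norm_integral_le_of_norm_le ((hI1.add hI2).const_mul c) (.of_forall fun z => ?_)
      have h1 := hprod (x + z) z (by
        have := norm_sub_le (x + z) z
        rw [add_sub_cancel_right] at this
        linarith)
      have h2 := hprod (x - z) z (by
        have := norm_add_le (x - z) z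
        rw [sub_add_cancel] at this
        linarith)
      rw [radialBump_eq_zero (by linarith : 2 ≤ ‖x‖), mul_zero, zero_sub, Real.norm_eq_abs,
        abs_div, abs_of_nonneg (by positivity : 0 ≤ ‖z‖ ^ ((n : ℝ) + α)), abs_of_nonpos
          (by linarith [radialBump_nonneg (x + z), radialBump_nonneg (x - z)]), mul_add]
      refine le_trans (le_of_eq ?_) (add_le_add h1 h2)
      ring
    rw [integral_const_mul, integral_add hI1 hI2] at hbd
    have e1 := integral_add_left_eq_self (μ := volume) 
      ((ball (0 : EuclideanSpace ℝ (Fin n)) 2).indicator (1 : EuclideanSpace ℝ (Fin n) → ℝ)) x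
    have e2 := integral_sub_left_eq_self
      ((ball (0 : EuclideanSpace ℝ (Fin n)) 2).indicator (1 : EuclideanSpace ℝ (Fin n) → ℝ)) volume x
    rw [e1, e2, hIV] at hbd
    rw [symLap, abs_mul, abs_of_pos one_half_pos]
    calc _ ≤ 1 / 2 * (c * (V + V)) := by gcongr
      _ = V * 4 ^ ((n : ℝ) + α) / (1 + ‖x‖) ^ ((n : ℝ) + α) := by rw [hc]; ring
      _ ≤ _ := by gcongr; exact le_max_right _ _

end radialBump

section ballIntegral

variable {n : ℕ} {α : ℝ}

lemma integral_truncKernel {ρ : ℝ} (hρ : 0 < ρ) :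
    ∫ z : EuclideanSpace ℝ (Fin n), truncKernel α ρ z
      = ρ ^ (-α) * ∫ z : EuclideanSpace ℝ (Fin n), truncKernel α 1 z := by
  have h := Measure.integral_comp_smul (volume : Measure (EuclideanSpace ℝ (Fin n)))
    (truncKernel α 1) ρ⁻¹
  have e : ∀ z : EuclideanSpace ℝ (Fin n),
      truncKernel α ρ z = ρ ^ (-((n : ℝ) + α)) * truncKernel α 1 (ρ⁻¹ • z) := by
    intro z
    have hiff : 1 < ρ⁻¹ * ‖z‖ ↔ ρ < ‖z‖ := by
      rw [inv_mul_eq_div, one_lt_div hρ]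
    by_cases hz : ρ < ‖z‖
    · simp only [truncKernel, Set.indicator, Set.mem_ofPred_eq, norm_smul, norm_inv,
        Real.norm_of_nonneg hρ.le, hiff, hz, if_true]
      rw [Real.mul_rpow (by positivity) (by positivity), Real.inv_rpow hρ.le, Real.rpow_neg hρ.le]
      have : 0 < ‖z‖ := hρ.trans hz
      field_simp
    · simp [truncKernel, Set.indicator, norm_smul, Real.norm_of_nonneg hρ.le, hiff, hz]
  rw [integral_congr_ae (.of_forall e), integral_const_mul, h]
  have : |((ρ⁻¹ ^ n)⁻¹ : ℝ)| = ρ ^ (n : ℝ) := by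
    rw [Real.rpow_natCast, inv_pow, inv_inv, abs_of_pos (by positivity)]
  rw [finrank_euclideanSpace_fin, this, smul_eq_mul]
  have : ρ ^ (-α) = ρ ^ (-((n : ℝ) + α)) * ρ ^ (n : ℝ) := by
    rw [← Real.rpow_add hρ]; congr 1; ring
  rw [this]; ring

lemma outFlux_integrand_nonneg {ε r : ℝ} {x z : EuclideanSpace ℝ (Fin n)} (hx : x ∈ ball 0 r)
    (hz : z ∈ (ball 0 r)ᶜ) : 0 ≤ (radialBump x - radialBump z) * truncKernel α ε (z - x) := by
  refine mul_nonneg (sub_nonneg.2 (radialBump_le_of_norm_le ?_)) (truncKernel_nonneg _ _ _)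
  simp only [mem_ball, dist_zero_right, Set.mem_compl_iff, not_lt] at hx hz
  linarith

/-- The flux `∫_{‖z‖ ≥ r} (φ(x) - φ(z)) k(z - x) dz` out of the ball of radius `r` for the radial
bump function `φ` and the truncated kernel `k`. -/
def outFlux (α ε r : ℝ) (x : EuclideanSpace ℝ (Fin n)) : ℝ :=
  ∫ z in (ball 0 r)ᶜ, (radialBump x - radialBump z) * truncKernel α ε (z - x)

lemma outFlux_nonneg {ε r : ℝ} {x : EuclideanSpace ℝ (Fin n)} (hx : x ∈ ball 0 r) :
    0 ≤ outFlux α ε r x :=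
  setIntegral_nonneg measurableSet_ball.compl fun _ hz => outFlux_integrand_nonneg hx hz

variable [NeZero n]

lemma volume_real_ball {r : ℝ} (hr : 0 ≤ r) (x : EuclideanSpace ℝ (Fin n)) :
    volume.real (ball x r) = r ^ n * volume.real (ball (0 : EuclideanSpace ℝ (Fin n)) 1) := by
  rw [measureReal_def, Measure.addHaar_ball volume x hr, ENNReal.toReal_mul,
    ENNReal.toReal_ofReal (by positivity), finrank_euclideanSpace_fin, measureReal_def]

lemma integrable_prod_flux (hα0 : 0 < α) (hα2 : α < 2) {ε : ℝ} (hε : 0 < ε) (r : ℝ) :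
    Integrable (Function.uncurry fun x z : EuclideanSpace ℝ (Fin n) =>
      (radialBump x - radialBump z) * truncKernel α ε (z - x))
      ((volume.restrict (ball 0 r)).prod volume) := by
  have hm : Measurable (Function.uncurry fun x z : EuclideanSpace ℝ (Fin n) =>
      truncKernel α ε (z - x)) :=
    (measurable_truncKernel α ε).comp (measurable_snd.sub measurable_fst)
  have hk : Integrable (Function.uncurry fun x z : EuclideanSpace ℝ (Fin n) =>
      truncKernel α ε (z - x)) ((volume.restrict (ball 0 r)).prod volume) := by
    rw [integrable_prod_iff hm.aestronglyMeasurable]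
    refine ⟨.of_forall fun x => (integrable_truncKernel hα0 hα2 hε).comp_sub_right x, ?_⟩
    have : ∀ x : EuclideanSpace ℝ (Fin n), ∫ z, ‖truncKernel α ε (z - x)‖
        = ∫ z : EuclideanSpace ℝ (Fin n), ‖truncKernel α ε z‖ := fun x =>
      integral_sub_right_eq_self (fun z => ‖truncKernel α ε z‖) x
    simp only [Function.uncurry, this]
    exact integrableOn_const (by finiteness) (by finiteness)
  have hb := hk.bdd_mul (c := 2) (f := fun p : EuclideanSpace ℝ (Fin n) × EuclideanSpace ℝ (Fin n) =>
    radialBump p.1 - radialBump p.2) ?_ (.of_forall fun p => ?_)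
  · exact hb.congr (.of_forall fun p => rfl)
  · have := (contDiff_radialBump (n := n)).continuous
    exact (by fun_prop : Continuous fun p : EuclideanSpace ℝ (Fin n) × EuclideanSpace ℝ (Fin n) =>
      radialBump p.1 - radialBump p.2).aestronglyMeasurable
  · rw [Real.norm_eq_abs, abs_le]
    constructor <;> linarith [radialBump_nonneg p.1, radialBump_nonneg p.2,
      radialBump_le_one p.1, radialBump_le_one p.2]

lemma integrable_flux (hα0 : 0 < α) (hα2 : α < 2) {ε : ℝ} (hε : 0 < ε)
    (x : EuclideanSpace ℝ (Fin n)) :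
    Integrable fun z => (radialBump x - radialBump z) * truncKernel α ε (z - x) := by
  simpa using (integrable_sub_mul_truncKernel hα0 hα2 contDiff_radialBump.continuous
    abs_radialBump_le_one hε x).comp_sub_right x

lemma integrableOn_outFlux (hα0 : 0 < α) (hα2 : α < 2) {ε : ℝ} (hε : 0 < ε) (r : ℝ) :
    IntegrableOn (outFlux (n := n) α ε r) (ball 0 r) :=
  ((integrable_prod_flux hα0 hα2 hε r).mono_measure
    (Measure.prod_mono le_rfl Measure.restrict_le_self)).integral_prod_left

lemma setIntegral_truncLap_eq (hα0 : 0 < α) (hα2 : α < 2) {ε : ℝ} (hε : 0 < ε) (r : ℝ) :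
    ∫ x in ball (0 : EuclideanSpace ℝ (Fin n)) r, truncLap α ε radialBump x
      = ∫ x in ball (0 : EuclideanSpace ℝ (Fin n)) r, outFlux α ε r x := by
  have hin : Integrable (Function.uncurry fun x z : EuclideanSpace ℝ (Fin n) =>
      (radialBump x - radialBump z) * truncKernel α ε (z - x))
      ((volume.restrict (ball 0 r)).prod (volume.restrict (ball 0 r))) :=
    (integrable_prod_flux hα0 hα2 hε r).mono_measure
      (Measure.prod_mono le_rfl Measure.restrict_le_self)
  have h0 : ∫ x in ball (0 : EuclideanSpace ℝ (Fin n)) r, ∫ z in ball 0 r,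
      (radialBump x - radialBump z) * truncKernel α ε (z - x) = 0 := by
    have h1 := integral_integral_swap hin
    have h2 : ∫ z in ball (0 : EuclideanSpace ℝ (Fin n)) r, ∫ x in ball 0 r,
        (radialBump x - radialBump z) * truncKernel α ε (z - x)
        = - ∫ x in ball (0 : EuclideanSpace ℝ (Fin n)) r, ∫ z in ball 0 r,
          (radialBump x - radialBump z) * truncKernel α ε (z - x) := by
      simp only [← integral_neg]
      refine integral_congr_ae (.of_forall fun z => integral_congr_ae (.of_forall fun x => ?_))
      simp only
      rw [← truncKernel_neg, neg_sub]; ring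
    linarith
  have hx : ∀ x : EuclideanSpace ℝ (Fin n), truncLap α ε radialBump x =
      (∫ z in ball 0 r, (radialBump x - radialBump z) * truncKernel α ε (z - x))
        + outFlux α ε r x := by
    intro x
    rw [outFlux, integral_add_compl measurableSet_ball (integrable_flux hα0 hα2 hε x), truncLap,
      ← integral_add_left_eq_self (fun z => (radialBump x - radialBump z) * truncKernel α ε (z - x)) x]
    simp only [add_sub_cancel_left]
  have hin' : IntegrableOn (fun x => ∫ z in ball 0 r,
      (radialBump x - radialBump z) * truncKernel α ε (z - x)) (ball 0 r) := hin.integral_prod_left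
  rw [integral_congr_ae (.of_forall hx), integral_add hin' (integrableOn_outFlux hα0 hα2 hε r), h0, zero_add]

lemma continuous_symLap_radialBump (hα0 : 0 < α) (hα2 : α < 2) :
    Continuous (symLap (n := n) α radialBump) := by
  obtain ⟨C, hC0, hC⟩ := exists_lipschitz_symLap hα0 hα2 (contDiff_radialBump (n := n))
    hasCompactSupport_radialBump
  refine (LipschitzWith.of_dist_le_mul (K := ⟨C, hC0⟩) fun x y => ?_).continuous
  rw [dist_eq_norm, dist_eq_norm]
  exact hC x y

lemma tendsto_setIntegral_outFlux (hα0 : 0 < α) (hα2 : α < 2) (r : ℝ) :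
    Tendsto (fun ε => ∫ x in ball (0 : EuclideanSpace ℝ (Fin n)) r, outFlux α ε r x) (𝓝[>] 0)
      (𝓝 (∫ x in ball (0 : EuclideanSpace ℝ (Fin n)) r, symLap α radialBump x)) := by
  obtain ⟨D, hD0, hD, -⟩ := exists_truncLap_radialBump_le (n := n) hα0 hα2
  obtain ⟨M, -, hM⟩ := exists_second_difference_radialBump_le (n := n)
  have h : Tendsto (fun ε => ∫ x in ball (0 : EuclideanSpace ℝ (Fin n)) r,
      truncLap α ε radialBump x) (𝓝[>] 0)
      (𝓝 (∫ x in ball (0 : EuclideanSpace ℝ (Fin n)) r, symLap α radialBump x)) := by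
    refine tendsto_integral_filter_of_dominated_convergence (fun _ => D) ?_ ?_ ?_ ?_
    · filter_upwards with ε
      have hm : Measurable (Function.uncurry fun x w : EuclideanSpace ℝ (Fin n) =>
          (radialBump x - radialBump (x + w)) * truncKernel α ε w) := by
        have := (contDiff_radialBump (n := n)).continuous
        refine Measurable.mul ?_ ((measurable_truncKernel α ε).comp measurable_snd)
        exact (by fun_prop : Continuous fun p : EuclideanSpace ℝ (Fin n) ×
          EuclideanSpace ℝ (Fin n) => radialBump p.1 - radialBump (p.1 + p.2)).measurable
      exact hm.stronglyMeasurable.integral_prod_right.aestronglyMeasurable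
    · filter_upwards [self_mem_nhdsWithin] with ε hε
      exact .of_forall fun x => hD ε hε x
    · exact integrableOn_const (by finiteness) (by finiteness)
    · exact .of_forall fun x => tendsto_truncLap hα0 hα2 contDiff_radialBump.continuous
        abs_radialBump_le_one hM x
  refine h.congr' ?_
  filter_upwards [self_mem_nhdsWithin] with ε hε using setIntegral_truncLap_eq hα0 hα2 hε r

lemma le_outFlux (hα0 : 0 < α) (hα2 : α < 2) {ε r R : ℝ} (hε : 0 < ε) (hε1 : ε < 1) (hR : 2 ≤ R)
    (hr : r ≤ R) {x : EuclideanSpace ℝ (Fin n)} (hxr : x ∈ ball 0 r) (hx : ‖x‖ ≤ 1) :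
    volume.real (ball (0 : EuclideanSpace ℝ (Fin n)) 1) * (4 ^ ((n : ℝ) + α))⁻¹ * R ^ (-α)
      ≤ outFlux α ε r x := by
  have hn : 1 ≤ n := NeZero.one_le
  let c : EuclideanSpace ℝ (Fin n) := EuclideanSpace.single ⟨0, hn⟩ (2 * R)
  have hcn : ‖c‖ = 2 * R := by simp [c, abs_of_nonneg (by linarith : 0 ≤ R)]
  have hz : ∀ z ∈ ball c R, R ≤ ‖z‖ ∧ ‖z‖ ≤ 3 * R := by
    intro z hz
    rw [mem_ball, dist_eq_norm] at hz
    have h1 := norm_sub_norm_le z c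
    have h2 := norm_sub_norm_le c z
    rw [norm_sub_rev] at h2
    constructor <;> linarith
  have hsub : ball c R ⊆ (ball 0 r)ᶜ := by
    intro z hz'
    simp only [Set.mem_compl_iff, mem_ball, dist_zero_right, not_lt]
    exact hr.trans (hz z hz').1
  have hle : ∀ z ∈ ball c R, ((4 * R) ^ ((n : ℝ) + α))⁻¹
      ≤ (radialBump x - radialBump z) * truncKernel α ε (z - x) := by
    intro z hz'
    obtain ⟨h1, h2⟩ := hz z hz'
    have h3 := norm_sub_norm_le z x
    have h4 := norm_sub_le z x
    have h5 : ε < ‖z - x‖ := by linarith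
    rw [radialBump_eq_one hx, radialBump_eq_zero (hR.trans h1), sub_zero, one_mul]
    simp only [truncKernel, Set.indicator, Set.mem_ofPred_eq, h5, if_true, one_div]
    have : 0 < ‖z - x‖ := hε.trans h5
    gcongr
    linarith
  have hint := (integrable_flux hα0 hα2 hε x).integrableOn (s := (ball 0 r)ᶜ)
  calc _ = ∫ z in ball c R, ((4 * R) ^ ((n : ℝ) + α))⁻¹ := by
        rw [setIntegral_const, volume_real_ball (by linarith : 0 ≤ R) c, smul_eq_mul,
          Real.mul_rpow (by norm_num) (by linarith), mul_inv, Real.rpow_neg (by linarith),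
          Real.rpow_add (by linarith : 0 < R), Real.rpow_natCast]
        have : 0 < R := by linarith
        field_simp
    _ ≤ ∫ z in ball c R, (radialBump x - radialBump z) * truncKernel α ε (z - x) :=
        setIntegral_mono_on (integrableOn_const (by finiteness) (by finiteness))
          (hint.mono_set hsub) measurableSet_ball hle
    _ ≤ _ := setIntegral_mono_set hint
        ((ae_restrict_iff' measurableSet_ball.compl).2
          (.of_forall fun z hz => outFlux_integrand_nonneg hxr hz)) hsub.eventuallyLE

lemma outFlux_le (hα0 : 0 < α) (hα2 : α < 2) {ε r : ℝ} (hr : 4 ≤ r)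
    (x : EuclideanSpace ℝ (Fin n)) :
    outFlux α ε r x ≤ (ball 0 2).indicator
      (fun _ => (r / 4) ^ (-α) * ∫ z : EuclideanSpace ℝ (Fin n), truncKernel α 1 z) x := by
  have hz2 : ∀ z ∈ (ball (0 : EuclideanSpace ℝ (Fin n)) r)ᶜ, r ≤ ‖z‖ := by
    intro z hz; simpa using hz
  by_cases hx : x ∈ ball (0 : EuclideanSpace ℝ (Fin n)) 2
  · rw [Set.indicator_of_mem hx, ← integral_truncKernel (by linarith),
      ← integral_sub_right_eq_self _ x]
    have hx' : ‖x‖ < 2 := by simpa using hx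
    have hI := (integrable_truncKernel (n := n) hα0 hα2 (by linarith : 0 < r / 4)).comp_sub_right x
    refine le_trans ?_ (setIntegral_le_integral (s := (ball 0 r)ᶜ) hI
      (.of_forall fun z => truncKernel_nonneg _ _ _))
    refine integral_mono_of_nonneg ((ae_restrict_iff' measurableSet_ball.compl).2
      (.of_forall fun z hz => outFlux_integrand_nonneg (ball_subset_ball (by linarith) hx) hz))
      hI.integrableOn ((ae_restrict_iff' measurableSet_ball.compl).2
      (.of_forall fun z hz => ?_))
    have h1 := hz2 z hz
    have h2 := norm_sub_norm_le z x
    have h3 : r / 4 < ‖z - x‖ := by linarith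
    simp only
    rw [radialBump_eq_zero (by linarith : 2 ≤ ‖z‖), sub_zero]
    calc _ ≤ 1 * (1 / ‖z - x‖ ^ ((n : ℝ) + α)) := by
          gcongr
          · exact truncKernel_nonneg _ _ _
          · exact radialBump_le_one x
          · exact truncKernel_le _ _ _
      _ = _ := by simp [truncKernel, Set.indicator, h3]
  · rw [Set.indicator_of_notMem hx]
    have hx' : 2 ≤ ‖x‖ := by simpa using hx
    refine setIntegral_nonpos measurableSet_ball.compl fun z hz => ?_
    rw [radialBump_eq_zero hx', radialBump_eq_zero (by linarith [hz2 z hz]), sub_zero, zero_mul]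

lemma exists_le_setIntegral_symLap (hα0 : 0 < α) (hα2 : α < 2) :
    ∃ c : ℝ, 0 < c ∧ ∀ r > 0, c * r ^ n * (1 + r) ^ (-((n : ℝ) + α))
      ≤ ∫ x in ball (0 : EuclideanSpace ℝ (Fin n)) r, symLap α radialBump x := by
  set V := volume.real (ball (0 : EuclideanSpace ℝ (Fin n)) 1) with hV
  have hV0 : 0 < V := ENNReal.toReal_pos (measure_ball_pos volume 0 one_pos).ne' (by finiteness)
  refine ⟨V * (V * (4 ^ ((n : ℝ) + α))⁻¹ * 2 ^ (-α)), by positivity, fun r hr => ?_⟩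
  refine ge_of_tendsto (tendsto_setIntegral_outFlux hα0 hα2 r) ?_
  have hev : ∀ᶠ ε in 𝓝[>] (0 : ℝ), ε < 1 := nhdsWithin_le_nhds (eventually_lt_nhds one_pos)
  filter_upwards [self_mem_nhdsWithin, hev] with ε hε hε1
  have hε : 0 < ε := hε
  have hsub : ball (0 : EuclideanSpace ℝ (Fin n)) (min r 1) ⊆ ball 0 r :=
    ball_subset_ball (min_le_left _ _)
  have hmin : 0 < min r 1 := lt_min hr one_pos
  have hmr : r / (1 + r) ≤ min r 1 := by
    rw [div_le_iff₀ (by positivity)]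
    rcases le_total r 1 with h | h
    · rw [min_eq_left h]; nlinarith
    · rw [min_eq_right h]; linarith
  calc _ = (r / (1 + r)) ^ n * V * (V * (4 ^ ((n : ℝ) + α))⁻¹ * (2 * (1 + r)) ^ (-α)) := by
        rw [neg_add, Real.rpow_add (by positivity : 0 < 1 + r), Real.mul_rpow (by norm_num) (by positivity),
          div_pow, Real.rpow_neg (by positivity) (n : ℝ), Real.rpow_natCast]
        ring
    _ ≤ (min r 1) ^ n * V * (V * (4 ^ ((n : ℝ) + α))⁻¹ * (2 * (1 + r)) ^ (-α)) := by
        gcongr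
    _ = ∫ x in ball (0 : EuclideanSpace ℝ (Fin n)) (min r 1),
          (V * (4 ^ ((n : ℝ) + α))⁻¹ * (2 * (1 + r)) ^ (-α)) := by
        rw [setIntegral_const, volume_real_ball hmin.le, smul_eq_mul]
    _ ≤ ∫ x in ball (0 : EuclideanSpace ℝ (Fin n)) (min r 1), outFlux α ε r x := by
        refine setIntegral_mono_on (integrableOn_const (by finiteness) (by finiteness))
          ((integrableOn_outFlux hα0 hα2 hε r).mono_set hsub) measurableSet_ball fun x hx => ?_
        refine le_outFlux hα0 hα2 hε hε1 (by linarith) (by linarith) (hsub hx) ?_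
        have : ‖x‖ < min r 1 := by simpa using hx
        exact (this.trans_le (min_le_right _ _)).le
    _ ≤ _ := setIntegral_mono_set (integrableOn_outFlux hα0 hα2 hε r)
        ((ae_restrict_iff' measurableSet_ball).2 (.of_forall fun x hx => outFlux_nonneg hx))
        hsub.eventuallyLE

lemma exists_setIntegral_symLap_le (hα0 : 0 < α) (hα2 : α < 2) :
    ∃ C : ℝ, 0 < C ∧ ∀ r > 0, ∫ x in ball (0 : EuclideanSpace ℝ (Fin n)) r, symLap α radialBump x
      ≤ C * r ^ n * (1 + r) ^ (-((n : ℝ) + α)) := by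
  obtain ⟨D, hD0, -, hD⟩ := exists_truncLap_radialBump_le (n := n) hα0 hα2
  set V := volume.real (ball (0 : EuclideanSpace ℝ (Fin n)) 1) with hV
  have hV0 : 0 < V := ENNReal.toReal_pos (measure_ball_pos volume 0 one_pos).ne' (by finiteness)
  set T := ∫ z : EuclideanSpace ℝ (Fin n), truncKernel α 1 z with hT
  have hT0 : 0 ≤ T := integral_nonneg fun z => truncKernel_nonneg _ _ _
  refine ⟨max (D * V * 5 ^ ((n : ℝ) + α)) (2 ^ n * V * (4 ^ α * T) * 2 ^ ((n : ℝ) + α)),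
    lt_max_of_lt_left (by positivity), fun r hr => ?_⟩
  rw [Real.rpow_neg (by positivity), ← div_eq_mul_inv]
  rcases lt_or_ge r 4 with h4 | h4
  · calc _ ≤ ∫ x in ball (0 : EuclideanSpace ℝ (Fin n)) r, D :=
          setIntegral_mono (((continuous_symLap_radialBump hα0 hα2).locallyIntegrable.integrableOn_isCompact
            (isCompact_closedBall 0 r)).mono_set ball_subset_closedBall)
            (integrableOn_const (by finiteness) (by finiteness)) fun x => (le_abs_self _).trans (hD x)
      _ = D * V * r ^ n := by
          rw [setIntegral_const, volume_real_ball hr.le, smul_eq_mul]; ring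
      _ ≤ D * V * 5 ^ ((n : ℝ) + α) * r ^ n / (1 + r) ^ ((n : ℝ) + α) := by
          rw [le_div_iff₀ (by positivity)]
          have : (1 + r) ^ ((n : ℝ) + α) ≤ 5 ^ ((n : ℝ) + α) := by gcongr; linarith
          calc _ ≤ D * V * r ^ n * 5 ^ ((n : ℝ) + α) := by gcongr
            _ = _ := by ring
      _ ≤ _ := by gcongr; exact le_max_left _ _
  · have hle : ∫ x in ball (0 : EuclideanSpace ℝ (Fin n)) r, symLap α radialBump x
        ≤ 2 ^ n * V * ((r / 4) ^ (-α) * T) := by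
      refine le_of_tendsto (tendsto_setIntegral_outFlux hα0 hα2 r) ?_
      filter_upwards [self_mem_nhdsWithin] with ε hε
      have hint : Integrable ((ball (0 : EuclideanSpace ℝ (Fin n)) 2).indicator
          fun _ => (r / 4) ^ (-α) * T) := by
        rw [integrable_indicator_iff measurableSet_ball]
        exact integrableOn_const (by finiteness) (by finiteness)
      calc _ ≤ ∫ x in ball (0 : EuclideanSpace ℝ (Fin n)) r,
            (ball (0 : EuclideanSpace ℝ (Fin n)) 2).indicator (fun _ => (r / 4) ^ (-α) * T) x :=
            setIntegral_mono (integrableOn_outFlux hα0 hα2 hε r) hint.integrableOn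
              fun x => outFlux_le hα0 hα2 h4 x
        _ ≤ ∫ x, (ball (0 : EuclideanSpace ℝ (Fin n)) 2).indicator
              (fun _ => (r / 4) ^ (-α) * T) x :=
            setIntegral_le_integral hint (.of_forall fun x =>
              Set.indicator_nonneg (fun _ _ => by positivity) x)
        _ = _ := by
            rw [integral_indicator measurableSet_ball, setIntegral_const,
              volume_real_ball (by norm_num), smul_eq_mul]
    refine hle.trans ?_
    calc _ = 2 ^ n * V * (4 ^ α * T) * r ^ n / r ^ ((n : ℝ) + α) := by
          rw [Real.rpow_neg (by positivity), Real.div_rpow hr.le (by norm_num), Real.rpow_add hr,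
            Real.rpow_natCast]
          field_simp
      _ ≤ 2 ^ n * V * (4 ^ α * T) * 2 ^ ((n : ℝ) + α) * r ^ n / (1 + r) ^ ((n : ℝ) + α) := by
          rw [div_le_div_iff₀ (by positivity) (by positivity)]
          have : (1 + r) ^ ((n : ℝ) + α) ≤ 2 ^ ((n : ℝ) + α) * r ^ ((n : ℝ) + α) := by
            rw [← Real.mul_rpow (by norm_num) hr.le]
            gcongr; linarith
          calc _ ≤ 2 ^ n * V * (4 ^ α * T) * r ^ n
                * (2 ^ ((n : ℝ) + α) * r ^ ((n : ℝ) + α)) := by gcongr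
            _ = _ := by ring
      _ ≤ _ := by gcongr; exact le_max_right _ _

end ballIntegral

section decay

variable {n : ℕ} {s : ℝ}

/-- The weight `(1 + ‖x‖) ^ (-s)`. -/
def decay (s : ℝ) (x : EuclideanSpace ℝ (Fin n)) : ℝ := (1 + ‖x‖) ^ (-s)

lemma decay_pos (s : ℝ) (x : EuclideanSpace ℝ (Fin n)) : 0 < decay s x := by
  unfold decay; positivity

lemma continuous_decay (s : ℝ) : Continuous (decay (n := n) s) := by
  unfold decay
  exact (by fun_prop : Continuous fun x : EuclideanSpace ℝ (Fin n) => 1 + ‖x‖).rpow_const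
    fun x => .inl (by positivity)

lemma decay_le_mul (hs : 0 ≤ s) {M : ℝ} (hM : 0 < M) {x y : EuclideanSpace ℝ (Fin n)}
    (h : 1 + ‖y‖ ≤ M * (1 + ‖x‖)) : decay s x ≤ M ^ s * decay s y := by
  unfold decay
  rw [Real.rpow_neg (by positivity), Real.rpow_neg (by positivity), ← div_eq_mul_inv,
    inv_le_comm₀ (by positivity) (by positivity), inv_div, div_le_iff₀' (by positivity),
    ← Real.mul_rpow hM.le (by positivity)]
  gcongr

lemma decay_le_of_norm_le (hs : 0 ≤ s) {x y : EuclideanSpace ℝ (Fin n)} (h : ‖y‖ ≤ ‖x‖) :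
    decay s x ≤ decay s y := by
  simpa using decay_le_mul hs one_pos (by linarith : 1 + ‖y‖ ≤ 1 * (1 + ‖x‖))

lemma decay_smul_sub_le (hs : 0 ≤ s) {t : ℝ} (ht : 0 < t) (x y : EuclideanSpace ℝ (Fin n)) :
    decay s (t • (x - y)) ≤ (1 + ‖x‖ + t⁻¹) ^ s * decay s y := by
  refine decay_le_mul hs (by positivity) ?_
  rw [norm_smul, Real.norm_of_nonneg ht.le]
  have h1 := norm_sub_norm_le y x
  rw [norm_sub_rev] at h1
  have h2 : t⁻¹ * (t * ‖x - y‖) = ‖x - y‖ := by field_simp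
  have h3 : 0 ≤ (1 + ‖x‖) * (t * ‖x - y‖) := by positivity
  have h4 : 0 < t⁻¹ := by positivity
  nlinarith

lemma integrable_decay (hs : (n : ℝ) < s) : Integrable (decay (n := n) s) :=
  integrable_one_add_norm (by simpa using hs)

lemma integrable_norm_rpow_mul_decay {γ : ℝ} (hγ : 0 ≤ γ) (hs : (n : ℝ) + γ < s) :
    Integrable fun x : EuclideanSpace ℝ (Fin n) => ‖x‖ ^ γ * decay s x := by
  refine (integrable_decay (n := n) (s := s - γ) (by linarith)).mono' ?_ (.of_forall fun x => ?_)
  · exact ((continuous_norm.rpow_const fun _ => .inr hγ).mul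
      (continuous_decay s)).aestronglyMeasurable
  · rw [Real.norm_of_nonneg (mul_nonneg (by positivity) (decay_pos s x).le)]
    unfold decay
    calc _ ≤ (1 + ‖x‖) ^ γ * (1 + ‖x‖) ^ (-s) := by gcongr; linarith
      _ = _ := by rw [← Real.rpow_add (by positivity)]; congr 1; ring

lemma InLalpha.integrable_mul_decay {α : ℝ} {u : EuclideanSpace ℝ (Fin n) → ℝ} (hα : 0 < α)
    (hu : InLalpha n α u) (hc : Continuous u) :
    Integrable fun y => u y * decay ((n : ℝ) + α) y := by
  refine (hu.norm.const_mul 2).mono' (hc.mul (continuous_decay _)).aestronglyMeasurable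
    (.of_forall fun y => ?_)
  rw [norm_mul, norm_div, Real.norm_of_nonneg (decay_pos _ y).le,
    Real.norm_of_nonneg (by positivity : 0 ≤ 1 + ‖y‖ ^ ((n : ℝ) + α)), mul_div_left_comm]
  gcongr
  unfold decay
  have hs : 0 ≤ (n : ℝ) + α := by positivity
  rw [Real.rpow_neg (by positivity), ← one_div, div_le_div_iff₀ (by positivity) (by positivity)]
  have h1 : 1 ≤ (1 + ‖y‖) ^ ((n : ℝ) + α) :=
    Real.one_le_rpow (by linarith [norm_nonneg y]) hs
  have h2 : ‖y‖ ^ ((n : ℝ) + α) ≤ (1 + ‖y‖) ^ ((n : ℝ) + α) := by gcongr; linarith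
  linarith

lemma InLalpha.integrable_mul_decay_smul_sub {α : ℝ} {u : EuclideanSpace ℝ (Fin n) → ℝ}
    (hα : 0 < α) (hu : InLalpha n α u) (hc : Continuous u) {t : ℝ} (ht : 0 < t)
    (x : EuclideanSpace ℝ (Fin n)) :
    Integrable fun y => u y * decay ((n : ℝ) + α) (t • (x - y)) := by
  have := continuous_decay (n := n) ((n : ℝ) + α)
  refine ((hu.integrable_mul_decay hα hc).norm.const_mul
    ((1 + ‖x‖ + t⁻¹) ^ ((n : ℝ) + α))).mono' (by fun_prop) (.of_forall fun y => ?_)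
  rw [norm_mul, norm_mul, Real.norm_of_nonneg (decay_pos _ _).le,
    Real.norm_of_nonneg (decay_pos _ _).le, mul_left_comm]
  gcongr
  exact decay_smul_sub_le (by positivity) ht x y

end decay

section dilationKernel

variable {n : ℕ} {α : ℝ}

/-- The kernel `∫₀¹ tⁿ⁻¹ (-Δ)^{α/2}φ(t x) dt` for the radial bump function `φ`. -/
def dilationKernel (α : ℝ) (x : EuclideanSpace ℝ (Fin n)) : ℝ :=
  ∫ t in (0 : ℝ)..1, t ^ (n - 1) * symLap α radialBump (t • x)

lemma symLap_radialBump_eq_of_norm_eq {x y : EuclideanSpace ℝ (Fin n)} (h : ‖x‖ = ‖y‖) :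
    symLap α radialBump x = symLap α radialBump y :=
  symLap_eq_of_norm_eq (fun _ _ h => (radialBump_le_of_norm_le h.ge).antisymm
    (radialBump_le_of_norm_le h.le)) h

lemma dilationKernel_eq_of_norm_eq {x y : EuclideanSpace ℝ (Fin n)} (h : ‖x‖ = ‖y‖) :
    dilationKernel α x = dilationKernel α y := by
  unfold dilationKernel
  refine intervalIntegral.integral_congr fun t _ => ?_
  rw [symLap_radialBump_eq_of_norm_eq (y := t • y) (by simp [norm_smul, h])]

variable [NeZero n]

lemma pow_mul_dilationKernel_smul (τ : ℝ) (x : EuclideanSpace ℝ (Fin n)) :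
    τ ^ n * dilationKernel α (τ • x)
      = ∫ t in (0 : ℝ)..τ, t ^ (n - 1) * symLap α radialBump (t • x) := by
  have h := intervalIntegral.mul_integral_comp_mul_right (a := 0) (b := 1)
    (f := fun t => t ^ (n - 1) * symLap α radialBump (t • x)) τ
  rw [zero_mul, one_mul] at h
  rw [← h, dilationKernel, ← intervalIntegral.integral_const_mul,
    ← intervalIntegral.integral_const_mul]
  refine intervalIntegral.integral_congr fun t _ => ?_
  rw [smul_smul, mul_pow, ← mul_pow_sub_one (NeZero.ne n) τ]
  ring

lemma norm_pow_mul_dilationKernel {x : EuclideanSpace ℝ (Fin n)} (hx : x ≠ 0) :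
    ∫ y in ball (0 : EuclideanSpace ℝ (Fin n)) ‖x‖, symLap α radialBump y
      = n * volume.real (ball (0 : EuclideanSpace ℝ (Fin n)) 1)
        * (‖x‖ ^ n * dilationKernel α x) := by
  have hx0 : 0 < ‖x‖ := norm_pos_iff.2 hx
  set e := ‖x‖⁻¹ • x with he
  have hen : ‖e‖ = 1 := by rw [he, norm_smul, norm_inv, norm_norm, inv_mul_cancel₀ hx0.ne']
  have hxe : x = ‖x‖ • e := by rw [he, smul_inv_smul₀ hx0.ne']
  have h := integral_fun_norm_addHaar (volume : Measure (EuclideanSpace ℝ (Fin n)))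
    ((Set.Iio ‖x‖).indicator fun s => symLap α radialBump (s • e))
  rw [finrank_euclideanSpace_fin] at h
  have h1 : ∀ y : EuclideanSpace ℝ (Fin n),
      (Set.Iio ‖x‖).indicator (fun s => symLap α radialBump (s • e)) ‖y‖
        = (ball 0 ‖x‖).indicator (symLap α radialBump) y := by
    intro y
    by_cases hy : ‖y‖ < ‖x‖
    · rw [Set.indicator_of_mem (by simpa using hy), Set.indicator_of_mem (by simpa using hy)]
      exact symLap_radialBump_eq_of_norm_eq (by simp [norm_smul, hen])
    · rw [Set.indicator_of_notMem (by simpa using hy), Set.indicator_of_notMem (by simpa using hy)]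
  have h2 : ∀ s : ℝ, s ^ (n - 1) • (Set.Iio ‖x‖).indicator
      (fun s => symLap α radialBump (s • e)) s
      = (Set.Iio ‖x‖).indicator (fun s => s ^ (n - 1) * symLap α radialBump (s • e)) s := by
    intro s
    by_cases hs : s < ‖x‖ <;> simp [Set.indicator, hs]
  rw [integral_congr_ae (.of_forall h1), integral_congr_ae (.of_forall h2),
    integral_indicator measurableSet_ball, setIntegral_indicator measurableSet_Iio,
    Set.Ioi_inter_Iio, ← integral_Ioc_eq_integral_Ioo,
    ← intervalIntegral.integral_of_le hx0.le, ← pow_mul_dilationKernel_smul, ← hxe] at h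
  rw [h, nsmul_eq_mul, smul_eq_mul, mul_assoc]

lemma abs_dilationKernel_sub_le {L : ℝ} (hL : 0 ≤ L) (hα0 : 0 < α) (hα2 : α < 2)
    (h : ∀ x y : EuclideanSpace ℝ (Fin n),
      |symLap α radialBump x - symLap α radialBump y| ≤ L * ‖x - y‖)
    (x y : EuclideanSpace ℝ (Fin n)) :
    |dilationKernel α x - dilationKernel α y| ≤ L * ‖x - y‖ := by
  have hc := continuous_symLap_radialBump (n := n) hα0 hα2
  have hi : ∀ x : EuclideanSpace ℝ (Fin n), IntervalIntegrable
      (fun t : ℝ => t ^ (n - 1) * symLap α radialBump (t • x)) volume 0 1 := fun x =>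
    (by fun_prop : Continuous fun t : ℝ =>
      t ^ (n - 1) * symLap α radialBump (t • x)).intervalIntegrable _ _
  unfold dilationKernel
  rw [← intervalIntegral.integral_sub (hi x) (hi y), ← Real.norm_eq_abs]
  refine (intervalIntegral.norm_integral_le_of_norm_le_const (C := L * ‖x - y‖)
    fun t ht => ?_).trans (by simp)
  rw [Set.uIoc_of_le zero_le_one] at ht
  rw [← mul_sub, norm_mul, Real.norm_of_nonneg (pow_nonneg ht.1.le _), Real.norm_eq_abs]
  calc _ ≤ 1 * (L * ‖t • x - t • y‖) := by
        gcongr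
        · exact pow_le_one₀ ht.1.le ht.2
        · exact h _ _
    _ = L * (t * ‖x - y‖) := by rw [← smul_sub, norm_smul, Real.norm_of_nonneg ht.1.le, one_mul]
    _ ≤ L * (1 * ‖x - y‖) := by gcongr; exact ht.2
    _ = _ := by ring

lemma continuous_dilationKernel (hα0 : 0 < α) (hα2 : α < 2) :
    Continuous (dilationKernel (n := n) α) := by
  obtain ⟨L, hL0, hL⟩ := exists_lipschitz_symLap hα0 hα2 (contDiff_radialBump (n := n))
    hasCompactSupport_radialBump
  refine (LipschitzWith.of_dist_le_mul (K := ⟨L, hL0⟩) fun x y => ?_).continuous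
  rw [dist_eq_norm, dist_eq_norm]
  exact abs_dilationKernel_sub_le hL0 hα0 hα2 hL x y

lemma forall_of_forall_ne_zero {f g : EuclideanSpace ℝ (Fin n) → ℝ} (hf : Continuous f)
    (hg : Continuous g) (h : ∀ x ≠ 0, f x ≤ g x) (x : EuclideanSpace ℝ (Fin n)) : f x ≤ g x := by
  have hd : Dense ({0}ᶜ : Set (EuclideanSpace ℝ (Fin n))) := dense_compl_singleton 0
  have : closure ({0}ᶜ : Set (EuclideanSpace ℝ (Fin n))) ⊆ {x | f x ≤ g x} :=
    closure_minimal (fun x hx => h x hx) (isClosed_le hf hg)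
  exact this (hd x)

lemma exists_decay_le_dilationKernel (hα0 : 0 < α) (hα2 : α < 2) :
    ∃ c : ℝ, 0 < c ∧ ∀ x : EuclideanSpace ℝ (Fin n),
      c * decay ((n : ℝ) + α) x ≤ dilationKernel α x := by
  obtain ⟨c, hc0, hc⟩ := exists_le_setIntegral_symLap (n := n) hα0 hα2
  set V := volume.real (ball (0 : EuclideanSpace ℝ (Fin n)) 1) with hV
  have hV0 : 0 < V := ENNReal.toReal_pos (measure_ball_pos volume 0 one_pos).ne' (by finiteness)
  have hn : 0 < n := NeZero.pos n
  refine ⟨c / (n * V), by positivity, forall_of_forall_ne_zero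
    (continuous_const.mul (continuous_decay _)) (continuous_dilationKernel hα0 hα2) fun x hx => ?_⟩
  have hx0 : 0 < ‖x‖ := norm_pos_iff.2 hx
  have h := hc ‖x‖ hx0
  rw [norm_pow_mul_dilationKernel hx, ← hV] at h
  rw [div_mul_eq_mul_div, div_le_iff₀ (by positivity)]
  refine le_of_mul_le_mul_left (a := ‖x‖ ^ n) ?_ (by positivity)
  unfold decay
  linarith

lemma exists_dilationKernel_le_decay (hα0 : 0 < α) (hα2 : α < 2) :
    ∃ C : ℝ, 0 < C ∧ ∀ x : EuclideanSpace ℝ (Fin n),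
      dilationKernel α x ≤ C * decay ((n : ℝ) + α) x := by
  obtain ⟨c, hc0, hc⟩ := exists_setIntegral_symLap_le (n := n) hα0 hα2
  set V := volume.real (ball (0 : EuclideanSpace ℝ (Fin n)) 1) with hV
  have hV0 : 0 < V := ENNReal.toReal_pos (measure_ball_pos volume 0 one_pos).ne' (by finiteness)
  have hn : 0 < n := NeZero.pos n
  refine ⟨c / (n * V), by positivity, forall_of_forall_ne_zero
    (continuous_dilationKernel hα0 hα2) (continuous_const.mul (continuous_decay _)) fun x hx => ?_⟩
  have hx0 : 0 < ‖x‖ := norm_pos_iff.2 hx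
  have h := hc ‖x‖ hx0
  rw [norm_pow_mul_dilationKernel hx, ← hV] at h
  rw [div_mul_eq_mul_div, le_div_iff₀ (by positivity)]
  refine le_of_mul_le_mul_left (a := ‖x‖ ^ n) ?_ (by positivity)
  unfold decay
  linarith

lemma dilationKernel_nonneg (hα0 : 0 < α) (hα2 : α < 2) (x : EuclideanSpace ℝ (Fin n)) :
    0 ≤ dilationKernel α x := by
  obtain ⟨c, hc0, hc⟩ := exists_decay_le_dilationKernel (n := n) hα0 hα2
  exact (mul_nonneg hc0.le (decay_pos _ x).le).trans (hc x)

/-- Comparison of the kernel at two points of a ray. -/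
lemma exists_abs_dilationKernel_smul_sub_le (hα0 : 0 < α) (hα2 : α < 2) :
    ∃ C : ℝ, 0 < C ∧ ∀ (l : ℝ) (x : EuclideanSpace ℝ (Fin n)), |l - 1| ≤ 1 / 2 →
      |dilationKernel α (l • x) - dilationKernel α x| ≤ C * |l - 1| * decay ((n : ℝ) + α) x := by
  obtain ⟨D, hD0, hD⟩ := exists_symLap_radialBump_decay (n := n) hα0 hα2
  obtain ⟨C, hC0, hC⟩ := exists_dilationKernel_le_decay (n := n) hα0 hα2
  have hc := continuous_symLap_radialBump (n := n) hα0 hα2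
  have hs : 0 ≤ (n : ℝ) + α := by positivity
  refine ⟨2 ^ (n - 1) * D * 2 ^ ((n : ℝ) + α) + n * 2 ^ (n - 1) * C * 2 ^ ((n : ℝ) + α),
    by positivity, fun l x hl => ?_⟩
  have hl' := abs_le.1 hl
  have hdec : ∀ t : ℝ, 1 / 2 ≤ t →
      decay ((n : ℝ) + α) (t • x) ≤ 2 ^ ((n : ℝ) + α) * decay ((n : ℝ) + α) x := by
    intro t ht
    refine decay_le_mul hs two_pos ?_
    rw [norm_smul, Real.norm_of_nonneg (by linarith)]
    nlinarith [norm_nonneg x]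
  have hi : ∀ a b : ℝ, IntervalIntegrable
      (fun t : ℝ => t ^ (n - 1) * symLap α radialBump (t • x)) volume a b := fun a b =>
    (by fun_prop : Continuous fun t : ℝ =>
      t ^ (n - 1) * symLap α radialBump (t • x)).intervalIntegrable _ _
  have h1 : |l ^ n * dilationKernel α (l • x) - dilationKernel α x|
      ≤ 2 ^ (n - 1) * (D * (2 ^ ((n : ℝ) + α) * decay ((n : ℝ) + α) x)) * |l - 1| := by
    have : dilationKernel α x = 1 ^ n * dilationKernel α ((1 : ℝ) • x) := by simp
    rw [this, pow_mul_dilationKernel_smul, pow_mul_dilationKernel_smul,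
      intervalIntegral.integral_interval_sub_left (hi _ _) (hi _ _), ← Real.norm_eq_abs]
    refine intervalIntegral.norm_integral_le_of_norm_le_const fun t ht => ?_
    have ht1 : 1 / 2 ≤ t := by
      rcases Set.mem_uIoc.1 ht with h | h <;> linarith [h.1]
    have ht2 : t ≤ 2 := by
      rcases Set.mem_uIoc.1 ht with h | h <;> linarith [h.2]
    rw [norm_mul, Real.norm_of_nonneg (by positivity), Real.norm_eq_abs]
    gcongr
    exact (hD _).trans (mul_le_mul_of_nonneg_left (hdec t ht1) hD0.le)
  have h2 : |l ^ n - 1| ≤ n * 2 ^ (n - 1) * |l - 1| := by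
    have := abs_pow_sub_pow_le l 1 n
    rw [one_pow, abs_one] at this
    refine this.trans ?_
    have hm : max |l| 1 ≤ 2 := by
      rw [abs_of_nonneg (by linarith)]; exact max_le (by linarith) (by norm_num)
    calc _ ≤ |l - 1| * n * 2 ^ (n - 1) := by gcongr
      _ = _ := by ring
  have h3 : |(l ^ n - 1) * dilationKernel α (l • x)|
      ≤ n * 2 ^ (n - 1) * |l - 1| * (C * (2 ^ ((n : ℝ) + α) * decay ((n : ℝ) + α) x)) := by
    rw [abs_mul, abs_of_nonneg (dilationKernel_nonneg hα0 hα2 (l • x))]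
    gcongr
    · exact dilationKernel_nonneg hα0 hα2 (l • x)
    · exact (hC _).trans (mul_le_mul_of_nonneg_left (hdec l (by linarith)) hC0.le)
  calc _ = |(l ^ n * dilationKernel α (l • x) - dilationKernel α x)
        - (l ^ n - 1) * dilationKernel α (l • x)| := by congr 1; ring
    _ ≤ _ := abs_sub _ _
    _ ≤ _ := add_le_add h1 h3
    _ = _ := by ring

lemma exists_abs_dilationKernel_sub_le_decay (hα0 : 0 < α) (hα2 : α < 2) :
    ∃ C : ℝ, 0 < C ∧ ∀ x y : EuclideanSpace ℝ (Fin n), ‖x - y‖ ≤ 1 →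
      |dilationKernel α x - dilationKernel α y| ≤ C * ‖x - y‖ * decay ((n : ℝ) + α) y := by
  obtain ⟨L, hL0, hL⟩ := exists_lipschitz_symLap hα0 hα2 (contDiff_radialBump (n := n))
    hasCompactSupport_radialBump
  obtain ⟨C, hC0, hC⟩ := exists_abs_dilationKernel_smul_sub_le (n := n) hα0 hα2
  refine ⟨C + L * 3 ^ ((n : ℝ) + α), by positivity, fun x y hxy => ?_⟩
  have hd := (decay_pos ((n : ℝ) + α) y).le
  rcases le_or_gt ‖y‖ 2 with hy | hy
  · have h3 : 1 ≤ 3 ^ ((n : ℝ) + α) * decay ((n : ℝ) + α) y := by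
      have := decay_le_mul (s := (n : ℝ) + α) (by positivity) (by norm_num : (0 : ℝ) < 3)
        (x := (0 : EuclideanSpace ℝ (Fin n))) (y := y) (by rw [norm_zero]; linarith)
      simpa [decay] using this
    calc _ ≤ L * ‖x - y‖ * 1 := by
          rw [mul_one]; exact abs_dilationKernel_sub_le hL0 hα0 hα2 hL x y
      _ ≤ L * ‖x - y‖ * (3 ^ ((n : ℝ) + α) * decay ((n : ℝ) + α) y) := by gcongr
      _ ≤ L * ‖x - y‖ * (3 ^ ((n : ℝ) + α) * decay ((n : ℝ) + α) y)
          + C * ‖x - y‖ * decay ((n : ℝ) + α) y := le_add_of_nonneg_right (by positivity)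
      _ = _ := by ring
  · have hy0 : 0 < ‖y‖ := by linarith
    set l := ‖x‖ / ‖y‖ with hl
    have hl1 : |l - 1| ≤ ‖x - y‖ / ‖y‖ := by
      rw [hl, div_sub_one hy0.ne', abs_div, abs_of_pos hy0]
      gcongr
      exact abs_norm_sub_norm_le x y
    have hl2 : ‖x - y‖ / ‖y‖ ≤ ‖x - y‖ / 2 := by gcongr
    have hxl : dilationKernel α x = dilationKernel α (l • y) := by
      refine dilationKernel_eq_of_norm_eq ?_
      rw [norm_smul, hl, norm_div, norm_norm, norm_norm, div_mul_cancel₀ _ hy0.ne']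
    rw [hxl]
    refine (hC l y (by linarith)).trans ?_
    have : |l - 1| ≤ ‖x - y‖ := by linarith [norm_nonneg (x - y)]
    have hC' : C ≤ C + L * 3 ^ ((n : ℝ) + α) := le_add_of_nonneg_right (by positivity)
    gcongr

end dilationKernel

section mollification

variable {n : ℕ} [NeZero n] {α : ℝ} {u : EuclideanSpace ℝ (Fin n) → ℝ}

/-- The mollification of `u` at scale `τ⁻¹` by `dilationKernel`. -/
def mollification (α : ℝ) (u : EuclideanSpace ℝ (Fin n) → ℝ) (τ : ℝ)
    (x : EuclideanSpace ℝ (Fin n)) : ℝ :=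
  ∫ y, u y * (τ ^ n * dilationKernel α (τ • (x - y)))

lemma integrable_mul_dilationKernel (hα0 : 0 < α) (hα2 : α < 2) (hu : InLalpha n α u)
    (hc : Continuous u) {τ : ℝ} (hτ : 0 < τ) (x : EuclideanSpace ℝ (Fin n)) :
    Integrable fun y => u y * (τ ^ n * dilationKernel α (τ • (x - y))) := by
  obtain ⟨C, hC0, hC⟩ := exists_dilationKernel_le_decay (n := n) hα0 hα2
  have hK := continuous_dilationKernel (n := n) hα0 hα2
  refine ((hu.integrable_mul_decay_smul_sub hα0 hc hτ x).norm.const_mul (τ ^ n * C)).mono'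
    (by fun_prop) (.of_forall fun y => ?_)
  have h0 := dilationKernel_nonneg hα0 hα2 (τ • (x - y))
  rw [norm_mul, Real.norm_of_nonneg (mul_nonneg (pow_nonneg hτ.le n) h0), norm_mul,
    Real.norm_of_nonneg (decay_pos _ _).le]
  calc _ ≤ ‖u y‖ * (τ ^ n * (C * decay ((n : ℝ) + α) (τ • (x - y)))) := by gcongr; exact hC _
    _ = _ := by ring

lemma mollification_eq (hα0 : 0 < α) (hα2 : α < 2) (hu : InLalpha n α u) (hc : Continuous u)
    (hh : AlphaHarmonic n α u) {a b : ℝ} (ha : 0 < a) (hab : a ≤ b)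
    (x : EuclideanSpace ℝ (Fin n)) : mollification α u b x = mollification α u a x := by
  obtain ⟨D, hD0, hD⟩ := exists_symLap_radialBump_decay (n := n) hα0 hα2
  have hg := continuous_symLap_radialBump (n := n) hα0 hα2
  have hi : ∀ (z : EuclideanSpace ℝ (Fin n)) (a b : ℝ), IntervalIntegrable
      (fun t : ℝ => t ^ (n - 1) * symLap α radialBump (t • z)) volume a b := fun z a b =>
    (by fun_prop : Continuous fun t : ℝ =>
      t ^ (n - 1) * symLap α radialBump (t • z)).intervalIntegrable _ _
  have hprod : Integrable (Function.uncurry fun (y : EuclideanSpace ℝ (Fin n)) (t : ℝ) =>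
      u y * (t ^ (n - 1) * symLap α radialBump (t • (x - y))))
      (volume.prod (volume.restrict (Set.Ioc a b))) := by
    have h1 := (((hu.integrable_mul_decay_smul_sub hα0 hc ha x).norm.const_mul
      (b ^ (n - 1) * D)).mul_prod (integrable_const (μ := volume.restrict (Set.Ioc a b)) (1 : ℝ)))
    have h2 : Continuous (Function.uncurry fun (y : EuclideanSpace ℝ (Fin n)) (t : ℝ) =>
        u y * (t ^ (n - 1) * symLap α radialBump (t • (x - y)))) := by
      unfold Function.uncurry; fun_prop
    refine h1.mono' h2.aestronglyMeasurable ?_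
    have hmem : ∀ᵐ p : EuclideanSpace ℝ (Fin n) × ℝ
        ∂(volume.prod (volume.restrict (Set.Ioc a b))), p.2 ∈ Set.Ioc a b :=
      Measure.quasiMeasurePreserving_snd.ae (ae_restrict_mem measurableSet_Ioc)
    filter_upwards [hmem] with p hp
    have hp0 : 0 < p.2 := ha.trans hp.1
    simp only [Function.uncurry, mul_one]
    rw [norm_mul, norm_mul, norm_mul, Real.norm_of_nonneg (by positivity : 0 ≤ p.2 ^ (n - 1)),
      Real.norm_of_nonneg (decay_pos _ _).le, Real.norm_eq_abs (symLap _ _ _)]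
    have h3 : |symLap α radialBump (p.2 • (x - p.1))|
        ≤ D * decay ((n : ℝ) + α) (a • (x - p.1)) := by
      refine (hD _).trans (mul_le_mul_of_nonneg_left (decay_le_of_norm_le (by positivity) ?_) hD0.le)
      rw [norm_smul, norm_smul, Real.norm_of_nonneg ha.le, Real.norm_of_nonneg hp0.le]
      gcongr
      exact hp.1.le
    calc _ ≤ ‖u p.1‖ * (b ^ (n - 1) * (D * decay ((n : ℝ) + α) (a • (x - p.1)))) := by
          gcongr
          · exact pow_nonneg (hp0.le.trans hp.2) _
          · exact hp.2
      _ = _ := by ring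
  rw [← sub_eq_zero, mollification, mollification,
    ← integral_sub (integrable_mul_dilationKernel hα0 hα2 hu hc (ha.trans_le hab) x)
      (integrable_mul_dilationKernel hα0 hα2 hu hc ha x)]
  have h1 : ∀ y, u y * (b ^ n * dilationKernel α (b • (x - y)))
      - u y * (a ^ n * dilationKernel α (a • (x - y)))
      = ∫ t in Set.Ioc a b, u y * (t ^ (n - 1) * symLap α radialBump (t • (x - y))) := by
    intro y
    rw [← mul_sub, pow_mul_dilationKernel_smul, pow_mul_dilationKernel_smul,
      intervalIntegral.integral_interval_sub_left (hi _ _ _) (hi _ _ _),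
      intervalIntegral.integral_of_le hab, integral_const_mul]
  rw [integral_congr_ae (.of_forall h1), integral_integral_swap hprod]
  refine setIntegral_eq_zero_of_forall_eq_zero fun t ht => ?_
  have h := integral_mul_symLap_dilation hα0 hα2 contDiff_radialBump hasCompactSupport_radialBump
    hh (inv_pos.2 (ha.trans ht.1)) x
  rw [inv_inv] at h
  simp only [mul_left_comm (u _), integral_const_mul, h, mul_zero]

lemma integrable_dilationKernel (hα0 : 0 < α) (hα2 : α < 2) :
    Integrable (dilationKernel (n := n) α) := by
  obtain ⟨C, hC0, hC⟩ := exists_dilationKernel_le_decay (n := n) hα0 hα2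
  refine ((integrable_decay (n := n) (s := (n : ℝ) + α) (by linarith)).const_mul C).mono'
    (continuous_dilationKernel hα0 hα2).aestronglyMeasurable (.of_forall fun x => ?_)
  rw [Real.norm_of_nonneg (dilationKernel_nonneg hα0 hα2 x)]
  exact hC x

lemma integrable_norm_rpow_mul_dilationKernel (hα0 : 0 < α) (hα2 : α < 2) {γ : ℝ} (hγ : 0 ≤ γ)
    (hγα : γ < α) :
    Integrable fun x : EuclideanSpace ℝ (Fin n) => ‖x‖ ^ γ * dilationKernel α x := by
  obtain ⟨C, hC0, hC⟩ := exists_dilationKernel_le_decay (n := n) hα0 hα2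
  refine ((integrable_norm_rpow_mul_decay (n := n) (s := (n : ℝ) + α) hγ (by linarith)).const_mul
    C).mono' ((continuous_norm.rpow_const fun _ => .inr hγ).mul
      (continuous_dilationKernel hα0 hα2)).aestronglyMeasurable (.of_forall fun x => ?_)
  have h0 := dilationKernel_nonneg hα0 hα2 x
  rw [Real.norm_of_nonneg (by positivity)]
  calc _ ≤ ‖x‖ ^ γ * (C * decay ((n : ℝ) + α) x) := by gcongr; exact hC x
    _ = _ := by ring

lemma integral_dilationKernel_pos (hα0 : 0 < α) (hα2 : α < 2) :
    0 < ∫ x : EuclideanSpace ℝ (Fin n), dilationKernel α x := by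
  obtain ⟨c, hc0, hc⟩ := exists_decay_le_dilationKernel (n := n) hα0 hα2
  rw [integral_pos_iff_support_of_nonneg (dilationKernel_nonneg hα0 hα2)
    (integrable_dilationKernel hα0 hα2)]
  have : Function.support (dilationKernel (n := n) α) = Set.univ :=
    Set.eq_univ_of_forall fun x => ((mul_pos hc0 (decay_pos _ x)).trans_le (hc x)).ne'
  rw [this]
  exact isOpen_univ.measure_pos volume Set.univ_nonempty

lemma tendsto_norm_pow_mul_dilationKernel (hα0 : 0 < α) (hα2 : α < 2) :
    Tendsto (fun x : EuclideanSpace ℝ (Fin n) => ‖x‖ ^ n * dilationKernel α x)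
      (Bornology.cobounded _) (𝓝 0) := by
  obtain ⟨C, hC0, hC⟩ := exists_dilationKernel_le_decay (n := n) hα0 hα2
  have h1 : Tendsto (fun x : EuclideanSpace ℝ (Fin n) => C * (1 + ‖x‖) ^ (-α))
      (Bornology.cobounded _) (𝓝 (C * 0)) :=
    ((tendsto_rpow_neg_atTop hα0).comp
      (tendsto_atTop_add_const_left _ 1 tendsto_norm_cobounded_atTop)).const_mul C
  rw [mul_zero] at h1
  refine squeeze_zero (fun x => mul_nonneg (by positivity) (dilationKernel_nonneg hα0 hα2 x))
    (fun x => ?_) h1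
  calc _ ≤ (1 + ‖x‖) ^ n * (C * decay ((n : ℝ) + α) x) := by
        gcongr
        · exact dilationKernel_nonneg hα0 hα2 x
        · linarith
        · exact hC x
    _ = _ := by
        have : (1 + ‖x‖) ^ (-α) = (1 + ‖x‖) ^ n * (1 + ‖x‖) ^ (-((n : ℝ) + α)) := by
          rw [← Real.rpow_natCast, ← Real.rpow_add (by positivity)]; congr 1; ring
        rw [this, decay]; ring

lemma tendsto_far_mollification (hα0 : 0 < α) (hα2 : α < 2) (hu : InLalpha n α u)
    (hc : Continuous u) (x : EuclideanSpace ℝ (Fin n)) :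
    Tendsto (fun τ : ℝ => ∫ y in (closedBall x 1)ᶜ, u y * (τ ^ n * dilationKernel α (τ • (x - y))))
      atTop (𝓝 0) := by
  obtain ⟨C, hC0, hC⟩ := exists_dilationKernel_le_decay (n := n) hα0 hα2
  set I := ∫ y, ‖u y * decay ((n : ℝ) + α) (x - y)‖ with hI
  have hint : Integrable fun y => u y * decay ((n : ℝ) + α) (x - y) := by
    simpa using hu.integrable_mul_decay_smul_sub hα0 hc one_pos x
  have h1 : Tendsto (fun τ : ℝ => C * 2 ^ ((n : ℝ) + α) * I * τ ^ (-α)) atTop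
      (𝓝 (C * 2 ^ ((n : ℝ) + α) * I * 0)) := (tendsto_rpow_neg_atTop hα0).const_mul _
  rw [mul_zero] at h1
  refine squeeze_zero_norm' ?_ h1
  filter_upwards [eventually_gt_atTop 0] with τ hτ
  have hb : ∀ y ∈ (closedBall x 1)ᶜ, ‖u y * (τ ^ n * dilationKernel α (τ • (x - y)))‖
      ≤ C * 2 ^ ((n : ℝ) + α) * τ ^ (-α) * ‖u y * decay ((n : ℝ) + α) (x - y)‖ := by
    intro y hy
    have hy1 : 1 < ‖x - y‖ := by
      simpa [mem_closedBall, dist_eq_norm, norm_sub_rev] using hy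
    have hd : decay ((n : ℝ) + α) (τ • (x - y))
        ≤ (2 / τ) ^ ((n : ℝ) + α) * decay ((n : ℝ) + α) (x - y) := by
      refine decay_le_mul (by positivity) (by positivity) ?_
      rw [norm_smul, Real.norm_of_nonneg hτ.le]
      have : 2 / τ * (1 + τ * ‖x - y‖) = 2 / τ + 2 * ‖x - y‖ := by field_simp
      have : 0 < 2 / τ := by positivity
      linarith
    have h0 := dilationKernel_nonneg hα0 hα2 (τ • (x - y))
    rw [norm_mul, Real.norm_of_nonneg (mul_nonneg (pow_nonneg hτ.le n) h0), norm_mul,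
      Real.norm_of_nonneg (decay_pos _ _).le]
    calc _ ≤ ‖u y‖ * (τ ^ n * (C * ((2 / τ) ^ ((n : ℝ) + α) * decay ((n : ℝ) + α) (x - y)))) := by
          gcongr
          exact (hC _).trans (mul_le_mul_of_nonneg_left hd hC0.le)
      _ = _ := by
          rw [Real.div_rpow (by norm_num) hτ.le, Real.rpow_neg hτ.le, Real.rpow_add hτ,
            Real.rpow_natCast]
          field_simp
  calc _ ≤ ∫ y in (closedBall x 1)ᶜ,
        C * 2 ^ ((n : ℝ) + α) * τ ^ (-α) * ‖u y * decay ((n : ℝ) + α) (x - y)‖ :=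
        norm_integral_le_of_norm_le (hint.norm.const_mul _).integrableOn
          ((ae_restrict_iff' measurableSet_closedBall.compl).2 (.of_forall hb))
    _ ≤ ∫ y, C * 2 ^ ((n : ℝ) + α) * τ ^ (-α) * ‖u y * decay ((n : ℝ) + α) (x - y)‖ :=
        setIntegral_le_integral (hint.norm.const_mul _) (.of_forall fun y => by positivity)
    _ = _ := by rw [integral_const_mul, hI]; ring

lemma tendsto_mollification (hα0 : 0 < α) (hα2 : α < 2) (hu : InLalpha n α u)
    (hc : Continuous u) (x : EuclideanSpace ℝ (Fin n)) :
    Tendsto (fun τ => mollification α u τ x) atTop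
      (𝓝 ((∫ z : EuclideanSpace ℝ (Fin n), dilationKernel α z) * u x)) := by
  set κ := ∫ z : EuclideanSpace ℝ (Fin n), dilationKernel α z with hκ
  have hκ0 : 0 < κ := integral_dilationKernel_pos hα0 hα2
  have hloc : IntegrableOn u (closedBall x 1) :=
    hc.locallyIntegrable.integrableOn_isCompact (isCompact_closedBall x 1)
  have hcont : ContinuousAt ((closedBall x 1).indicator u) x :=
    hc.continuousAt.congr (by
      filter_upwards [closedBall_mem_nhds x one_pos] with y hy
      rw [Set.indicator_of_mem hy])
  have h1 := tendsto_integral_comp_smul_smul_of_integrable' (μ := volume)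
    (φ := fun z : EuclideanSpace ℝ (Fin n) => κ⁻¹ * dilationKernel α z)
    (fun z => mul_nonneg (by positivity) (dilationKernel_nonneg hα0 hα2 z))
    (by rw [integral_const_mul, ← hκ, inv_mul_cancel₀ hκ0.ne'])
    (by
      have := (tendsto_norm_pow_mul_dilationKernel (n := n) hα0 hα2).const_mul κ⁻¹
      rw [mul_zero] at this
      refine this.congr fun z => ?_
      rw [finrank_euclideanSpace_fin]; ring)
    ((integrable_indicator_iff measurableSet_closedBall).2 hloc) hcont
  have h2 := (h1.const_mul κ).add (tendsto_far_mollification hα0 hα2 hu hc x)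
  rw [Set.indicator_of_mem (mem_closedBall_self zero_le_one), add_zero] at h2
  refine h2.congr' ?_
  filter_upwards [eventually_gt_atTop 0] with τ hτ
  rw [mollification, ← integral_add_compl (measurableSet_closedBall (x := x) (ε := 1))
    (integrable_mul_dilationKernel hα0 hα2 hu hc hτ x), ← integral_const_mul,
    ← integral_indicator measurableSet_closedBall]
  congr 1
  refine integral_congr_ae (.of_forall fun y => ?_)
  by_cases hy : y ∈ closedBall x 1
  · simp only [Set.indicator_of_mem hy, finrank_euclideanSpace_fin, smul_eq_mul]
    field_simp
  · simp only [Set.indicator_of_notMem hy, smul_zero, mul_zero]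

/-- If `u` is bounded below by `-(A + ε ‖y‖ ^ γ)`, its weighted absolute integrals are controlled
by its mollification. -/
lemma integral_abs_mul_dilationKernel_le (hα0 : 0 < α) (hα2 : α < 2) (hu : InLalpha n α u)
    (hc : Continuous u) {γ : ℝ} (hγ : 0 ≤ γ) (hγα : γ < α) {A ε : ℝ} (hA : 0 ≤ A) (hε : 0 ≤ ε)
    (h : ∀ y, -(A + ε * ‖y‖ ^ γ) ≤ u y) {τ : ℝ} (hτ : 0 < τ) :
    ∫ y, |u y| * (τ ^ n * dilationKernel α (τ • y)) ≤ mollification α u τ 0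
      + 2 * A * (∫ z : EuclideanSpace ℝ (Fin n), dilationKernel α z)
      + 2 * ε * (τ ^ (-γ) * ∫ z : EuclideanSpace ℝ (Fin n), ‖z‖ ^ γ * dilationKernel α z) := by
  have hev : ∀ y : EuclideanSpace ℝ (Fin n),
      dilationKernel α (τ • ((0 : EuclideanSpace ℝ (Fin n)) - y)) = dilationKernel α (τ • y) :=
    fun y => dilationKernel_eq_of_norm_eq (by simp)
  have i1 := integrable_mul_dilationKernel hα0 hα2 hu hc hτ 0
  simp only [hev] at i1
  have e1 : mollification α u τ 0 = ∫ y, u y * (τ ^ n * dilationKernel α (τ • y)) := by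
    simp only [mollification, hev]
  have e2 : ∫ y : EuclideanSpace ℝ (Fin n), τ ^ n * dilationKernel α (τ • y)
      = ∫ z : EuclideanSpace ℝ (Fin n), dilationKernel α z := by
    rw [integral_const_mul, Measure.integral_comp_smul, finrank_euclideanSpace_fin,
      abs_of_pos (by positivity), smul_eq_mul, mul_inv_cancel_left₀ (by positivity)]
  have i2 : Integrable fun y : EuclideanSpace ℝ (Fin n) =>
      τ ^ n * dilationKernel α (τ • y) :=
    ((integrable_dilationKernel hα0 hα2).comp_smul hτ.ne').const_mul _
  have e3' : ∀ y : EuclideanSpace ℝ (Fin n), ‖y‖ ^ γ * (τ ^ n * dilationKernel α (τ • y))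
      = τ ^ (-γ) * (τ ^ n * (‖τ • y‖ ^ γ * dilationKernel α (τ • y))) := by
    intro y
    rw [norm_smul, Real.norm_of_nonneg hτ.le, Real.mul_rpow hτ.le (norm_nonneg y),
      Real.rpow_neg hτ.le]
    field_simp
  have hm := integrable_norm_rpow_mul_dilationKernel (n := n) hα0 hα2 hγ hγα
  have i3 : Integrable fun y : EuclideanSpace ℝ (Fin n) =>
      ‖y‖ ^ γ * (τ ^ n * dilationKernel α (τ • y)) := by
    simp only [e3']
    exact ((hm.comp_smul hτ.ne').const_mul _).const_mul _
  have e3 : ∫ y : EuclideanSpace ℝ (Fin n), ‖y‖ ^ γ * (τ ^ n * dilationKernel α (τ • y))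
      = τ ^ (-γ) * ∫ z : EuclideanSpace ℝ (Fin n), ‖z‖ ^ γ * dilationKernel α z := by
    simp only [e3']
    rw [integral_const_mul, integral_const_mul, Measure.integral_comp_smul volume
      (fun z : EuclideanSpace ℝ (Fin n) => ‖z‖ ^ γ * dilationKernel α z),
      finrank_euclideanSpace_fin, abs_of_pos (by positivity), smul_eq_mul,
      mul_inv_cancel_left₀ (by positivity)]
  have i12 : Integrable fun y => u y * (τ ^ n * dilationKernel α (τ • y))
      + 2 * A * (τ ^ n * dilationKernel α (τ • y)) := i1.add (i2.const_mul _)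
  rw [e1, ← e2, ← e3, ← integral_const_mul, ← integral_const_mul,
    ← integral_add i1 (i2.const_mul _), ← integral_add i12 (i3.const_mul _)]
  refine integral_mono_of_nonneg (.of_forall fun y => ?_)
    (i12.add (i3.const_mul _)) (.of_forall fun y => ?_)
  · have := dilationKernel_nonneg hα0 hα2 (τ • y)
    simp only [Pi.zero_apply]
    positivity
  · have h0 : 0 ≤ τ ^ n * dilationKernel α (τ • y) :=
      mul_nonneg (by positivity) (dilationKernel_nonneg hα0 hα2 _)
    have h1 : |u y| ≤ u y + 2 * A + 2 * ε * ‖y‖ ^ γ := by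
      have := h y
      have h2 : 0 ≤ ε * ‖y‖ ^ γ := by positivity
      rw [abs_le]; constructor <;> linarith
    calc _ ≤ (u y + 2 * A + 2 * ε * ‖y‖ ^ γ) * (τ ^ n * dilationKernel α (τ • y)) :=
          mul_le_mul_of_nonneg_right h1 h0
      _ = _ := by ring

lemma exists_abs_mollification_sub_le (hα0 : 0 < α) (hα2 : α < 2) (hu : InLalpha n α u)
    (hc : Continuous u) :
    ∃ B : ℝ, 0 < B ∧ ∀ (x : EuclideanSpace ℝ (Fin n)) (τ : ℝ), 0 < τ → τ * ‖x‖ ≤ 1 →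
      |mollification α u τ x - mollification α u τ 0|
        ≤ B * (τ * ‖x‖) * ∫ y, |u y| * (τ ^ n * dilationKernel α (τ • y)) := by
  obtain ⟨c, hc0, hcK⟩ := exists_decay_le_dilationKernel (n := n) hα0 hα2
  obtain ⟨C, hC0, hC⟩ := exists_abs_dilationKernel_sub_le_decay (n := n) hα0 hα2
  refine ⟨C / c, by positivity, fun x τ hτ hx => ?_⟩
  have i1 := integrable_mul_dilationKernel hα0 hα2 hu hc hτ
  have i2 : Integrable fun y => |u y| * (τ ^ n * dilationKernel α (τ • y)) := by
    refine (i1 0).norm.congr (.of_forall fun y => ?_)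
    have h0 := dilationKernel_nonneg hα0 hα2 (τ • ((0 : EuclideanSpace ℝ (Fin n)) - y))
    simp only
    rw [norm_mul, Real.norm_of_nonneg (mul_nonneg (pow_nonneg hτ.le n) h0), Real.norm_eq_abs,
      dilationKernel_eq_of_norm_eq (y := τ • y) (by simp)]
  rw [mollification, mollification, ← integral_sub (i1 x) (i1 0), ← Real.norm_eq_abs,
    ← integral_const_mul]
  refine norm_integral_le_of_norm_le (i2.const_mul _) (.of_forall fun y => ?_)
  have e : τ • (x - y) - τ • (0 - y) = τ • x := by rw [← smul_sub]; congr 1; abel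
  have hn : ‖τ • x‖ = τ * ‖x‖ := by rw [norm_smul, Real.norm_of_nonneg hτ.le]
  have h1 := hC (τ • (x - y)) (τ • (0 - y)) (by rw [e, hn]; exact hx)
  rw [e, hn] at h1
  have h2 : decay ((n : ℝ) + α) (τ • (0 - y)) ≤ dilationKernel α (τ • y) / c := by
    rw [le_div_iff₀' hc0, ← dilationKernel_eq_of_norm_eq (x := τ • (0 - y)) (by simp)]
    exact hcK _
  rw [← mul_sub, ← mul_sub, norm_mul, norm_mul, Real.norm_of_nonneg (by positivity : 0 ≤ τ ^ n),
    Real.norm_eq_abs, Real.norm_eq_abs]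
  calc _ ≤ |u y| * (τ ^ n * (C * (τ * ‖x‖) * (dilationKernel α (τ • y) / c))) := by
        gcongr
        exact h1.trans (by gcongr)
    _ = _ := by ring

end mollification

lemma exists_neg_le_of_liminf {n : ℕ} {γ : ℝ} {u : EuclideanSpace ℝ (Fin n) → ℝ}
    (hc : Continuous u) {ε : ℝ} (hε : 0 ≤ ε)
    (h : ∀ᶠ x in comap (fun x : EuclideanSpace ℝ (Fin n) => ‖x‖) atTop, -ε ≤ u x / ‖x‖ ^ γ) :
    ∃ A : ℝ, 0 ≤ A ∧ ∀ y, -(A + ε * ‖y‖ ^ γ) ≤ u y := by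
  obtain ⟨R, hR⟩ := eventually_atTop.1 (eventually_comap.1 h)
  obtain ⟨A, hA⟩ := (isCompact_closedBall (0 : EuclideanSpace ℝ (Fin n))
    (max R 1)).exists_bound_of_continuousOn hc.continuousOn
  refine ⟨max A 0, le_max_right _ _, fun y => ?_⟩
  have h0 : 0 ≤ ε * ‖y‖ ^ γ := by positivity
  have hA0 : A ≤ max A 0 := le_max_left _ _
  have hA1 : 0 ≤ max A 0 := le_max_right _ _
  by_cases hy : ‖y‖ ≤ max R 1
  · have := neg_le_of_abs_le (hA y (by simpa using hy))
    linarith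
  · rw [not_le, max_lt_iff] at hy
    have := hR ‖y‖ hy.1.le y rfl
    rw [le_div_iff₀ (Real.rpow_pos_of_pos (by linarith) _)] at this
    linarith

/-- Liouville theorem: an `α`-harmonic function `u ∈ L_α` with
`liminf_{|x|→∞} u(x)/|x|^γ ≥ 0` for some `0 ≤ γ ≤ 1`, `γ < α`, is constant. -/
theorem liouville_fractional (n : ℕ) (hn : 1 ≤ n) (α : ℝ) (hα0 : 0 < α) (hα2 : α < 2)
    (γ : ℝ) (hγ0 : 0 ≤ γ) (hγ1 : γ ≤ 1) (hγα : γ < α)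
    (u : EuclideanSpace ℝ (Fin n) → ℝ) (hu_cont : Continuous u)
    (hu_L : InLalpha n α u) (hu_harm : AlphaHarmonic n α u)
    (hliminf : ∀ ε > (0 : ℝ),
      ∀ᶠ x in Filter.comap (fun x : EuclideanSpace ℝ (Fin n) => ‖x‖) atTop,
        -ε ≤ u x / ‖x‖ ^ γ) :
    ∃ C : ℝ, ∀ x, u x = C := by
  have : NeZero n := ⟨by omega⟩
  set κ := ∫ z : EuclideanSpace ℝ (Fin n), dilationKernel α z
  have hκ0 : 0 < κ := integral_dilationKernel_pos hα0 hα2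
  set M := ∫ z : EuclideanSpace ℝ (Fin n), ‖z‖ ^ γ * dilationKernel α z
  have hM0 : 0 ≤ M := integral_nonneg fun z =>
    mul_nonneg (by positivity) (dilationKernel_nonneg hα0 hα2 z)
  have hconst : ∀ x, ∀ τ > 0, mollification α u τ x = mollification α u 1 x := by
    intro x τ hτ
    rcases le_total τ 1 with h | h
    · exact (mollification_eq hα0 hα2 hu_L hu_cont hu_harm hτ h x).symm
    · exact mollification_eq hα0 hα2 hu_L hu_cont hu_harm one_pos h x
  have hval : ∀ x, mollification α u 1 x = κ * u x := fun x =>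
    tendsto_nhds_unique (tendsto_const_nhds.congr' (by
      filter_upwards [eventually_gt_atTop 0] with τ hτ using (hconst x τ hτ).symm))
      (tendsto_mollification hα0 hα2 hu_L hu_cont x)
  obtain ⟨B, hB0, hB⟩ := exists_abs_mollification_sub_le hα0 hα2 hu_L hu_cont
  have key : ∀ x, ∀ ε > 0, |mollification α u 1 x - mollification α u 1 0|
      ≤ ε * (2 * B * ‖x‖ * M) := by
    intro x ε hε
    obtain ⟨A, hA0, hA⟩ := exists_neg_le_of_liminf hu_cont hε.le (hliminf ε hε)
    have hlim : Tendsto (fun τ : ℝ => B * (τ * ‖x‖) * (mollification α u 1 0 + 2 * A * κ)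
        + ε * (2 * B * ‖x‖ * M)) (𝓝[>] 0) (𝓝 (ε * (2 * B * ‖x‖ * M))) := by
      refine (Continuous.tendsto' (by fun_prop) 0 _ (by simp)).mono_left nhdsWithin_le_nhds
    refine ge_of_tendsto hlim ?_
    have h1 : ∀ᶠ τ in 𝓝[>] (0 : ℝ), τ < 1 := nhdsWithin_le_nhds (eventually_lt_nhds one_pos)
    have h2 : ∀ᶠ τ in 𝓝[>] (0 : ℝ), τ < 1 / (‖x‖ + 1) :=
      nhdsWithin_le_nhds (eventually_lt_nhds (by positivity))
    filter_upwards [self_mem_nhdsWithin, h1, h2] with τ hτ hτ1 hτx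
    have hτ : 0 < τ := hτ
    have hτx' : τ * ‖x‖ ≤ 1 := by
      rw [lt_div_iff₀ (by positivity)] at hτx
      linarith
    have h3 := hB x τ hτ hτx'
    have h4 := integral_abs_mul_dilationKernel_le hα0 hα2 hu_L hu_cont hγ0 hγα hA0 hε.le hA hτ
    rw [hconst x τ hτ, hconst 0 τ hτ] at h3
    rw [hconst 0 τ hτ] at h4
    have h5 : τ * τ ^ (-γ) ≤ 1 := by
      rw [Real.rpow_neg hτ.le, ← div_eq_mul_inv, div_le_one (by positivity)]
      simpa using Real.rpow_le_rpow_of_exponent_ge hτ hτ1.le hγ1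
    calc _ ≤ B * (τ * ‖x‖) * (mollification α u 1 0 + 2 * A * κ + 2 * ε * (τ ^ (-γ) * M)) :=
          h3.trans (by gcongr)
      _ = B * (τ * ‖x‖) * (mollification α u 1 0 + 2 * A * κ)
          + ε * (2 * B * ‖x‖ * M) * (τ * τ ^ (-γ)) := by ring
      _ ≤ B * (τ * ‖x‖) * (mollification α u 1 0 + 2 * A * κ) + ε * (2 * B * ‖x‖ * M) * 1 := by
          gcongr
      _ = _ := by ring
  refine ⟨u 0, fun x => ?_⟩
  have hlim : Tendsto (fun ε : ℝ => ε * (2 * B * ‖x‖ * M)) (𝓝[>] 0) (𝓝 0) :=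
    (Continuous.tendsto' (by fun_prop) 0 _ (by simp)).mono_left nhdsWithin_le_nhds
  have h0 : |mollification α u 1 x - mollification α u 1 0| ≤ 0 :=
    ge_of_tendsto hlim (by filter_upwards [self_mem_nhdsWithin] with ε hε using key x ε hε)
  have h1 := sub_eq_zero.1 (abs_nonpos_iff.1 h0)
  rw [hval, hval] at h1
  exact mul_left_cancel₀ hκ0.ne' h1
end
end

section
/- Let n ≥ 1, m ≥ 1 an integer, and let u be a tempered distribution on ℝⁿ satisfying (-Δ)^m u = 0, i.e., ⟨u, (-Δ)^m ψ⟩ = 0 for every Schwartz function ψ on ℝⁿ. Then u is a polynomial: there exists a polynomial p in n variables such that ⟨u, ψ⟩ = ∫_{ℝⁿ} p(x) ψ(x) dx for every Schwartz function ψ. -/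
open MeasureTheory Filter Topology

noncomputable section

/-- The pointwise Laplacian `Δf(x) = Σᵢ ∂²f/∂xᵢ²(x)`. -/
def lapPt (n : ℕ) (f : EuclideanSpace ℝ (Fin n) → ℝ)
    (x : EuclideanSpace ℝ (Fin n)) : ℝ :=
  ∑ i : Fin n,
    iteratedFDeriv ℝ 2 f x ![EuclideanSpace.single i 1, EuclideanSpace.single i 1]

open scoped SchwartzMap ContDiff

/-- A continuous functional on Schwartz space is controlled by finitely many seminorms. -/
theorem SchwartzMap.exists_bound_of_continuousLinearMap {E F : Type*}
    [NormedAddCommGroup E] [NormedSpace ℝ E] [NormedAddCommGroup F] [NormedSpace ℝ F]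
    (T : 𝓢(E, F) →L[ℝ] ℝ) :
    ∃ (N : ℕ) (C : ℝ), 0 ≤ C ∧ ∀ (f : 𝓢(E, F)) (M : ℝ), 0 ≤ M →
      (∀ k n, n ≤ N → SchwartzMap.seminorm ℝ k n f ≤ M) → |T f| ≤ C * M := by
  obtain ⟨s, C, -, h⟩ := Seminorm.bound_of_continuous (schwartz_withSeminorms ℝ E F)
    ((normSeminorm ℝ ℝ).comp T.toLinearMap) (by exact continuous_norm.comp T.continuous)
  refine ⟨s.sup Prod.snd, C, C.2, fun f M hM hf => (h f).trans ?_⟩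
  refine mul_le_mul_of_nonneg_left ?_ C.2
  refine Seminorm.finset_sup_apply_le hM fun i hi => hf _ _ (Finset.le_sup (f := Prod.snd) hi)

/-- Derivatives of a Schwartz function vanishing at the origin to order `M` are controlled by
powers of the norm. -/
theorem SchwartzMap.exists_norm_iteratedFDeriv_le_of_iteratedFDeriv_zero {E F : Type*}
    [NormedAddCommGroup E] [NormedSpace ℝ E] [NormedAddCommGroup F] [NormedSpace ℝ F]
    (f : 𝓢(E, F)) (j k : ℕ)
    (hf : ∀ i, k ≤ i → i < k + j → iteratedFDeriv ℝ i f 0 = 0) :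
    ∃ C, 0 ≤ C ∧ ∀ x, ‖iteratedFDeriv ℝ k f x‖ ≤ C * ‖x‖ ^ j := by
  induction j generalizing k with
  | zero =>
    exact ⟨SchwartzMap.seminorm ℝ 0 k f, apply_nonneg _ _, fun x => by
      simpa using f.norm_iteratedFDeriv_le_seminorm ℝ k x⟩
  | succ j ih =>
    obtain ⟨C, hC, h⟩ := ih (k + 1) fun i hi hi' => hf i (by omega) (by omega)
    refine ⟨C, hC, fun x => ?_⟩
    have hd : Differentiable ℝ (iteratedFDeriv ℝ k f) :=
      (f.smooth ⊤).differentiable_iteratedFDeriv (mod_cast WithTop.coe_lt_top _)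
    have := (convex_closedBall (0 : E) ‖x‖).norm_image_sub_le_of_norm_fderiv_le
      (f := iteratedFDeriv ℝ k f) (C := C * ‖x‖ ^ j) (x := 0) (y := x)
      (𝕜 := ℝ) (fun y _ => hd y) (fun y hy => ?_) (by simp) (by simp)
    · rw [hf k le_rfl (by omega)] at this
      simpa [pow_succ, mul_assoc] using this
    · rw [norm_fderiv_iteratedFDeriv]
      refine (h y).trans ?_
      have : ‖y‖ ≤ ‖x‖ := by simpa using hy
      gcongr

/-- A smooth cutoff supported in the unit ball, with complement divisible by `‖x‖ ^ (2 * m)` within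
functions of temperate growth. -/
theorem exists_cutoff_one_sub_eq_norm_pow_mul (E : Type*)
    [NormedAddCommGroup E] [InnerProductSpace ℝ E] [FiniteDimensional ℝ E] (m : ℕ) :
    ∃ χ ρ : E → ℝ, ContDiff ℝ ∞ χ ∧ (∀ x, 1 ≤ ‖x‖ → χ x = 0) ∧ ρ.HasTemperateGrowth ∧
      ∀ x, 1 - χ x = ‖x‖ ^ (2 * m) * ρ x := by
  let β : ContDiffBump (0 : ℝ) := ⟨1 / 2, 3 / 4, by norm_num, by norm_num⟩
  let w : E → ℝ := fun x => (1 + ‖x‖ ^ 2) ^ (-1 : ℝ)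
  have hw : w.HasTemperateGrowth := Function.hasTemperateGrowth_one_add_norm_sq_rpow E (-1)
  have hwe : ∀ x, w x = (1 + ‖x‖ ^ 2)⁻¹ := fun x => Real.rpow_neg_one _
  let F : ℝ → ℝ := fun t => β t * (t / (1 - t)) ^ m
  have hβ : ContDiff ℝ ∞ β := β.contDiff
  have hF : ContDiff ℝ ∞ F := by
    rw [contDiff_iff_contDiffAt]
    intro t
    by_cases ht : t = 1
    · have h0 : F =ᶠ[𝓝 t] fun _ => 0 := by
        filter_upwards [lt_mem_nhds (show (3 / 4 : ℝ) < t by rw [ht]; norm_num)] with s hs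
        have : β s = 0 := β.zero_of_le_dist (by
          rw [Real.dist_eq, sub_zero, abs_of_pos (by linarith)]; exact hs.le)
        simp [F, this]
      exact contDiffAt_const.congr_of_eventuallyEq h0
    · have : (1 - t) ≠ 0 := sub_ne_zero.2 (Ne.symm ht)
      exact hβ.contDiffAt.mul
        ((contDiffAt_id.div (contDiffAt_const.sub contDiffAt_id) this).pow m)
  have hFc : HasCompactSupport F := β.hasCompactSupport.mul_right
  refine ⟨fun x => 1 - β (w x), F ∘ w, contDiff_const.sub (hβ.comp hw.1), fun x hx => ?_,
    (hFc.hasTemperateGrowth hF).comp hw, fun x => ?_⟩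
  · have : β (w x) = 1 := β.one_of_mem_closedBall (by
      rw [mem_closedBall_zero_iff, Real.norm_eq_abs, hwe, abs_of_pos (by positivity)]
      change _ ≤ (1 / 2 : ℝ)
      rw [one_div]
      gcongr
      nlinarith)
    simp [this]
  · by_cases hx : x = 0
    · have : β (w x) = 0 := β.zero_of_le_dist (by
        rw [Real.dist_eq, hwe, hx]; simp; change (3 / 4 : ℝ) ≤ 1; norm_num)
      simp [F, this]
    · have hx' : ‖x‖ ≠ 0 := norm_ne_zero_iff.2 hx
      have h1 : w x / (1 - w x) = (‖x‖ ^ 2)⁻¹ := by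
        rw [hwe]
        have : (1 + ‖x‖ ^ 2) ≠ 0 := by positivity
        have h2 : 1 - (1 + ‖x‖ ^ 2)⁻¹ = ‖x‖ ^ 2 * (1 + ‖x‖ ^ 2)⁻¹ := by field_simp; ring
        rw [h2]
        field_simp
      simp only [Function.comp, F, h1, pow_mul]
      rw [mul_left_comm, ← mul_pow, mul_inv_cancel₀ (by positivity)]
      simp

/-- Multiplying by a concentrating cutoff makes finitely many seminorms of a function vanishing to
high order at the origin small. -/
theorem SchwartzMap.exists_seminorm_cutoff_le {E F : Type*}
    [NormedAddCommGroup E] [NormedSpace ℝ E] [FiniteDimensional ℝ E]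
    [NormedAddCommGroup F] [NormedSpace ℝ F]
    {χ : E → ℝ} (hχ : ContDiff ℝ ∞ χ) (hχ0 : ∀ x, 1 ≤ ‖x‖ → χ x = 0) (f : 𝓢(E, F)) (N : ℕ)
    (hf : ∀ i ≤ N, iteratedFDeriv ℝ i f 0 = 0) :
    ∃ C, 0 ≤ C ∧ ∀ ε : ℝ, 0 < ε → ε ≤ 1 → ∀ g : 𝓢(E, F), (∀ x, g x = χ (ε⁻¹ • x) • f x) →
      ∀ k n, n ≤ N → SchwartzMap.seminorm ℝ k n g ≤ C * ε := by
  have hχc : HasCompactSupport χ :=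
    HasCompactSupport.of_support_subset_isCompact (isCompact_closedBall (0 : E) 1) fun x hx => by
      by_contra h
      exact hx (hχ0 x (by simpa using (not_le.1 (by simpa using h)).le))
  have hB : ∀ i, ∃ B, ∀ x, ‖iteratedFDeriv ℝ i χ x‖ ≤ B := fun i => by
    obtain ⟨B, hB⟩ := (hχ.continuous_iteratedFDeriv
      (m := i) (mod_cast le_top)).bounded_above_of_compact_support (hχc.iteratedFDeriv i)
    exact ⟨B, hB⟩
  choose B hB using hB
  have hB0 : ∀ i, 0 ≤ B i := fun i => (norm_nonneg _).trans (hB i 0)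
  have hA : ∀ i, ∃ A, 0 ≤ A ∧ ∀ x, i ≤ N → ‖iteratedFDeriv ℝ i f x‖ ≤ A * ‖x‖ ^ (N + 1 - i) :=
    fun i => by
      by_cases hi : i ≤ N
      · obtain ⟨A, hA, h⟩ := f.exists_norm_iteratedFDeriv_le_of_iteratedFDeriv_zero (N + 1 - i) i
          fun l _ hl => hf l (by omega)
        exact ⟨A, hA, fun x _ => h x⟩
      · exact ⟨0, le_rfl, fun x h => absurd h hi⟩
  choose A hA0 hA using hA
  let D : ℕ → ℝ := fun n => ∑ i ∈ Finset.range (n + 1), (n.choose i : ℝ) * B i * A (n - i)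
  have hD : ∀ n, 0 ≤ D n := fun n => Finset.sum_nonneg fun i _ =>
    mul_nonneg (mul_nonneg (Nat.cast_nonneg _) (hB0 i)) (hA0 _)
  refine ⟨∑ n ∈ Finset.range (N + 1), D n, Finset.sum_nonneg fun n _ => hD n, ?_⟩
  intro ε hε hε1 g hg k n hn
  have hgf : (g : E → F) = fun x => χ (ε⁻¹ • x) • f x := funext hg
  refine SchwartzMap.seminorm_le_bound ℝ k n g
    (mul_nonneg (Finset.sum_nonneg fun n _ => hD n) hε.le) fun x => ?_
  have hDn : D n ≤ ∑ n ∈ Finset.range (N + 1), D n :=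
    Finset.single_le_sum (f := D) (fun n _ => hD n) (by simpa [Nat.lt_succ_iff] using hn)
  refine le_trans ?_ (mul_le_mul_of_nonneg_right hDn hε.le)
  by_cases hx : ‖x‖ ≤ ε
  · have hs : ContDiff ℝ ∞ fun x : E => χ (ε⁻¹ • x) := hχ.comp (contDiff_const_smul _)
    have hle := norm_iteratedFDeriv_smul_le (n := n) hs (f.smooth ⊤) x (mod_cast le_top)
    rw [← hgf] at hle
    have hxk : ‖x‖ ^ k ≤ 1 := pow_le_one₀ (norm_nonneg _) (hx.trans hε1)
    calc ‖x‖ ^ k * ‖iteratedFDeriv ℝ n g x‖ ≤ 1 * ‖iteratedFDeriv ℝ n g x‖ := by gcongr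
      _ = ‖iteratedFDeriv ℝ n g x‖ := one_mul _
      _ ≤ _ := hle
      _ ≤ D n * ε := by
        rw [Finset.sum_mul]
        refine Finset.sum_le_sum fun i hi => ?_
        have hin : i ≤ n := by simpa [Nat.lt_succ_iff] using hi
        have e1 : ‖iteratedFDeriv ℝ i (fun x : E => χ (ε⁻¹ • x)) x‖ ≤ ε⁻¹ ^ i * B i := by
          rw [iteratedFDeriv_comp_const_smul _ (hχ.of_le (mod_cast le_top))]
          simp only [norm_smul, norm_pow, norm_inv, Real.norm_eq_abs, abs_of_pos hε]
          gcongr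
          exact hB i _
        have e2 : ‖iteratedFDeriv ℝ (n - i) f x‖ ≤ A (n - i) * (ε ^ i * ε) := by
          refine (hA (n - i) x (by omega)).trans ?_
          refine mul_le_mul_of_nonneg_left ?_ (hA0 _)
          rw [← pow_succ]
          exact (pow_le_pow_left₀ (norm_nonneg _) hx _).trans
            (pow_le_pow_of_le_one hε.le hε1 (by omega))
        calc _ ≤ (n.choose i : ℝ) * (ε⁻¹ ^ i * B i) * (A (n - i) * (ε ^ i * ε)) := by
              gcongr
              exact mul_nonneg (Nat.cast_nonneg _) (mul_nonneg (by positivity) (hB0 i))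
          _ = (n.choose i : ℝ) * B i * A (n - i) * ε * (ε⁻¹ ^ i * ε ^ i) := by ring
          _ = _ := by rw [← mul_pow, inv_mul_cancel₀ hε.ne', one_pow, mul_one]
  · have hsub : tsupport g ⊆ Metric.closedBall 0 ε := by
      refine closure_minimal (fun y hy => ?_) Metric.isClosed_closedBall
      by_contra h
      refine hy ?_
      rw [hg, hχ0, zero_smul]
      rw [norm_smul, norm_inv, Real.norm_eq_abs, abs_of_pos hε, inv_mul_eq_div, one_le_div hε]
      exact (not_le.1 (by simpa using h)).le
    have : iteratedFDeriv ℝ n g x = 0 := by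
      by_contra h
      exact hx (by simpa using hsub (support_iteratedFDeriv_subset n h))
    rw [this]
    simpa using mul_nonneg (hD n) hε.le

/-- A tempered distribution annihilated by `‖x‖ ^ (2 * m)` only depends on finitely many
derivatives of the test function at the origin. -/
theorem SchwartzMap.exists_order_of_norm_pow_smul_eq_zero {E F : Type*}
    [NormedAddCommGroup E] [InnerProductSpace ℝ E] [FiniteDimensional ℝ E]
    [NormedAddCommGroup F] [NormedSpace ℝ F] (m : ℕ) (T : 𝓢(E, F) →L[ℝ] ℝ)
    (hT : ∀ f g : 𝓢(E, F), (∀ x, g x = ‖x‖ ^ (2 * m) • f x) → T g = 0) :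
    ∃ N : ℕ, ∀ f : 𝓢(E, F), (∀ i ≤ N, iteratedFDeriv ℝ i f 0 = 0) → T f = 0 := by
  obtain ⟨N, K, hK, hTK⟩ := SchwartzMap.exists_bound_of_continuousLinearMap T
  refine ⟨N, fun f hf => ?_⟩
  obtain ⟨χ, ρ, hχ, hχ0, hρ, hχρ⟩ := exists_cutoff_one_sub_eq_norm_pow_mul E m
  obtain ⟨C, hC, hCε⟩ := f.exists_seminorm_cutoff_le hχ hχ0 N hf
  have key : ∀ ε : ℝ, 0 < ε → ε ≤ 1 → |T f| ≤ K * (C * ε) := fun ε hε hε1 => by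
    have hρε : (fun x : E => ε⁻¹ ^ (2 * m) * ρ (ε⁻¹ • x)).HasTemperateGrowth :=
      (Function.HasTemperateGrowth.const _).mul
        (hρ.comp ((ε⁻¹ • ContinuousLinearMap.id ℝ E).hasTemperateGrowth))
    let r := SchwartzMap.smulLeftCLM F (fun x : E => ε⁻¹ ^ (2 * m) * ρ (ε⁻¹ • x)) f
    have hr : ∀ x, r x = (ε⁻¹ ^ (2 * m) * ρ (ε⁻¹ • x)) • f x := fun x =>
      SchwartzMap.smulLeftCLM_apply_apply hρε f x
    let q := SchwartzMap.smulLeftCLM F (fun x : E => ‖x‖ ^ (2 * m)) r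
    have hq : ∀ x, q x = ‖x‖ ^ (2 * m) • r x := fun x =>
      SchwartzMap.smulLeftCLM_apply_apply (by simp_rw [pow_mul]; fun_prop) r x
    have hfq : T f = T (f - q) := by rw [map_sub, hT r q hq, sub_zero]
    rw [hfq]
    refine hTK _ _ (by positivity) (hCε ε hε hε1 _ fun x => ?_)
    have := hχρ (ε⁻¹ • x)
    have h2 : χ (ε⁻¹ • x) = 1 - ‖x‖ ^ (2 * m) * (ε⁻¹ ^ (2 * m) * ρ (ε⁻¹ • x)) := by
      rw [norm_smul, norm_inv, Real.norm_eq_abs, abs_of_pos hε] at this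
      rw [← mul_assoc, ← mul_pow, mul_comm ‖x‖]
      linarith
    rw [sub_apply, hq, hr, h2, sub_smul, one_smul, smul_smul]
  have hlim : Tendsto (fun ε : ℝ => K * (C * ε)) (𝓝[>] 0) (𝓝 0) := by
    have : Tendsto (fun ε : ℝ => K * (C * ε)) (𝓝 0) (𝓝 (K * (C * 0))) :=
      Continuous.tendsto (by fun_prop) 0
    simpa using this.mono_left nhdsWithin_le_nhds
  have : |T f| ≤ 0 := ge_of_tendsto hlim (by
    filter_upwards [Ioc_mem_nhdsGT (zero_lt_one' ℝ)] with ε hε using key ε hε.1 hε.2)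
  simpa using this

open scoped FourierTransform Laplacian LineDeriv

/-- On Schwartz functions `lapPt` is the Laplacian. -/
theorem lapPt_coe_schwartzMap {n : ℕ} (f : 𝓢(EuclideanSpace ℝ (Fin n), ℝ)) :
    lapPt n f = ⇑(Δ f : 𝓢(EuclideanSpace ℝ (Fin n), ℝ)) := by
  ext x
  rw [SchwartzMap.laplacian_apply, InnerProductSpace.laplacian_eq_iteratedFDeriv_orthonormalBasis
    (⇑f) (EuclideanSpace.basisFun (Fin n) ℝ)]
  simp [lapPt]

theorem lapPt_iterate_coe_schwartzMap {n : ℕ} (f : 𝓢(EuclideanSpace ℝ (Fin n), ℝ)) (m : ℕ) :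
    (lapPt n)^[m] f = ⇑((Laplacian.laplacian (F := 𝓢(EuclideanSpace ℝ (Fin n), ℝ)))^[m] f) := by
  induction m generalizing f with
  | zero => rfl
  | succ m ih => rw [Function.iterate_succ_apply, lapPt_coe_schwartzMap, ih,
      Function.iterate_succ_apply]

/-- The Laplacian commutes with postcomposition by a continuous linear map. -/
theorem SchwartzMap.laplacian_postcompCLM {E F G : Type*}
    [NormedAddCommGroup E] [InnerProductSpace ℝ E] [FiniteDimensional ℝ E]
    [NormedAddCommGroup F] [NormedSpace ℝ F] [NormedAddCommGroup G] [NormedSpace ℝ G]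
    (L : F →L[ℝ] G) (f : 𝓢(E, F)) :
    Δ (SchwartzMap.postcompCLM L f) = SchwartzMap.postcompCLM L (Δ f) := by
  ext x
  rw [SchwartzMap.laplacian_apply, SchwartzMap.postcompCLM_apply, SchwartzMap.laplacian_apply]
  exact ((f.smooth 2).contDiffAt).laplacian_CLM_comp_left

theorem SchwartzMap.laplacian_iterate_postcompCLM {E F G : Type*}
    [NormedAddCommGroup E] [InnerProductSpace ℝ E] [FiniteDimensional ℝ E]
    [NormedAddCommGroup F] [NormedSpace ℝ F] [NormedAddCommGroup G] [NormedSpace ℝ G]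
    (L : F →L[ℝ] G) (f : 𝓢(E, F)) (m : ℕ) :
    (Laplacian.laplacian (F := 𝓢(E, G)))^[m] (SchwartzMap.postcompCLM L f) =
      SchwartzMap.postcompCLM L ((Laplacian.laplacian (F := 𝓢(E, F)))^[m] f) := by
  induction m generalizing f with
  | zero => rfl
  | succ m ih => rw [Function.iterate_succ_apply, laplacian_postcompCLM, ih,
      Function.iterate_succ_apply]

/-- The iterated Laplacian of an inverse Fourier transform. -/
theorem SchwartzMap.laplacian_iterate_fourierInv {E : Type*}
    [NormedAddCommGroup E] [InnerProductSpace ℝ E] [FiniteDimensional ℝ E]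
    [MeasurableSpace E] [BorelSpace E] (m : ℕ) (f g : 𝓢(E, ℂ))
    (hg : ∀ x, g x = ‖x‖ ^ (2 * m) • f x) :
    (Laplacian.laplacian (F := 𝓢(E, ℂ)))^[m] (𝓕⁻ f) =
      ((-(2 * Real.pi) ^ 2) ^ m : ℝ) • 𝓕⁻ g := by
  induction m generalizing f g with
  | zero =>
    have : g = f := by ext x; simpa using hg x
    simp [this]
  | succ m ih =>
    let h := SchwartzMap.smulLeftCLM ℂ (fun x : E => ‖x‖ ^ 2) f
    have hh : ∀ x, h x = ‖x‖ ^ 2 • f x := fun x =>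
      SchwartzMap.smulLeftCLM_apply_apply (by fun_prop) f x
    have hΔ : Δ (𝓕⁻ f) = (-(2 * Real.pi) ^ 2 : ℝ) • 𝓕⁻ h := by
      rw [SchwartzMap.laplacian_eq_fourierMultiplierCLM, SchwartzMap.fourierMultiplierCLM_apply,
        FourierTransform.fourier_fourierInv_eq]
    rw [Function.iterate_succ_apply, hΔ, ← FourierTransform.fourierInv_smul,
      ih ((-(2 * Real.pi) ^ 2 : ℝ) • h) ((-(2 * Real.pi) ^ 2 : ℝ) • g) fun x => ?_,
      FourierTransform.fourierInv_smul, smul_smul, ← pow_succ]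
    rw [smul_apply, smul_apply, hg, hh]
    simp only [smul_smul]
    congr 1
    ring

/-- Polynomial functions have temperate growth. -/
theorem MvPolynomial.hasTemperateGrowth_eval {n : ℕ} (p : MvPolynomial (Fin n) ℝ) :
    (fun x : EuclideanSpace ℝ (Fin n) => MvPolynomial.eval (fun i => x i) p).HasTemperateGrowth := by
  induction p using MvPolynomial.induction_on with
  | C a => simp
  | add p q hp hq =>
    simp only [map_add]
    exact hp.add hq
  | mul_X p i hp =>
    simp only [map_mul, MvPolynomial.eval_X]
    exact hp.mul (EuclideanSpace.proj (𝕜 := ℝ) i).hasTemperateGrowth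

/-- Integration of Schwartz functions against a polynomial, as a linear function of both. -/
def polynomialIntegral (n : ℕ) :
    MvPolynomial (Fin n) ℝ →ₗ[ℝ] 𝓢(EuclideanSpace ℝ (Fin n), ℝ) →ₗ[ℝ] ℝ :=
  have hfi : ∀ (p : MvPolynomial (Fin n) ℝ) (f : 𝓢(EuclideanSpace ℝ (Fin n), ℝ)),
      Integrable fun x : EuclideanSpace ℝ (Fin n) => MvPolynomial.eval (fun i => x i) p * f x :=
    fun p f => by
      have := (SchwartzMap.smulLeftCLM ℝ (fun x : EuclideanSpace ℝ (Fin n) =>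
        MvPolynomial.eval (fun i => x i) p) f).integrable (μ := volume)
      refine this.congr (ae_of_all _ fun x => ?_)
      exact SchwartzMap.smulLeftCLM_apply_apply p.hasTemperateGrowth_eval f x
  LinearMap.mk₂ ℝ (fun p f => ∫ x : EuclideanSpace ℝ (Fin n),
      MvPolynomial.eval (fun i => x i) p * f x)
    (fun p q f => by simp only [map_add, add_mul]; exact integral_add (hfi p f) (hfi q f))
    (fun c p f => by
      simp only [MvPolynomial.smul_eval, mul_assoc, integral_const_mul, smul_eq_mul])
    (fun p f g => by
      simp only [add_apply, mul_add]; exact integral_add (hfi p f) (hfi p g))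
    (fun c p f => by
      simp only [smul_apply, smul_eq_mul, mul_left_comm _ c, integral_const_mul])

theorem polynomialIntegral_apply {n : ℕ} (p : MvPolynomial (Fin n) ℝ)
    (f : 𝓢(EuclideanSpace ℝ (Fin n), ℝ)) :
    polynomialIntegral n p f =
      ∫ x : EuclideanSpace ℝ (Fin n), MvPolynomial.eval (fun i => x i) p * f x := rfl

/-- If the moments of order `k` of a Schwartz function vanish, then so does the `k`-th derivative
of its Fourier transform at the origin. -/
theorem SchwartzMap.iteratedFDeriv_fourier_ofReal_eq_zero {n : ℕ}
    (f : 𝓢(EuclideanSpace ℝ (Fin n), ℝ)) (k : ℕ)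
    (hf : ∀ J : Fin k → Fin n, polynomialIntegral n (∏ j, MvPolynomial.X (J j)) f = 0) :
    iteratedFDeriv ℝ k (𝓕 (SchwartzMap.postcompCLM Complex.ofRealCLM f) :
      𝓢(EuclideanSpace ℝ (Fin n), ℂ)) 0 = 0 := by
  set g := SchwartzMap.postcompCLM Complex.ofRealCLM f with hg
  have hgi : ∀ l : ℕ, Integrable fun v => ‖v‖ ^ l * ‖g v‖ := fun l => g.integrable_pow_mul volume l
  have hgm : AEStronglyMeasurable g volume := g.continuous.aestronglyMeasurable
  rw [SchwartzMap.fourier_coe,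
    Real.iteratedFDeriv_fourier (N := ⊤) (fun l _ => hgi l) hgm le_top, Real.fourier_eq]
  have hI := VectorFourier.integrable_fourierPowSMulRight (innerSL ℝ) (hgi k) hgm
  simp only [inner_zero_right, neg_zero, AddChar.map_zero_eq_one, one_smul]
  apply ContinuousMultilinearMap.toMultilinearMap_injective
  refine Module.Basis.ext_multilinear (fun _ => (EuclideanSpace.basisFun (Fin n) ℝ).toBasis)
    fun J => ?_
  have h0 : ∫ x : EuclideanSpace ℝ (Fin n), (∏ j, x (J j)) * f x = 0 := by
    simpa [polynomialIntegral_apply] using hf J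
  simp only [ContinuousMultilinearMap.coe_coe, OrthonormalBasis.coe_toBasis,
    ContinuousMultilinearMap.toMultilinearMap_zero, _root_.zero_apply]
  rw [ContinuousMultilinearMap.integral_apply hI]
  simp only [VectorFourier.fourierPowSMulRight_apply, EuclideanSpace.basisFun_apply]
  rw [integral_smul]
  have : ∀ x : EuclideanSpace ℝ (Fin n),
      (∏ j, innerSL ℝ x (EuclideanSpace.single (J j) (1 : ℝ))) • g x =
        (((∏ j, x (J j)) * f x : ℝ) : ℂ) := fun x => by
    change (∏ j, inner ℝ x (EuclideanSpace.single (J j) (1 : ℝ))) • g x = _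
    simp [hg, EuclideanSpace.inner_single_right]
  rw [integral_congr_ae (ae_of_all _ this), integral_complex_ofReal, h0]
  simp

/-- A polyharmonic tempered distribution is a polynomial: if `u` is a tempered
distribution on `ℝⁿ` with `(-Δ)^m u = 0` (i.e. `⟨u, (-Δ)^m ψ⟩ = 0` for every Schwartz `ψ`),
then `u` is represented by a polynomial. -/
theorem polyharmonic_tempered_distribution_is_polynomial
    (n : ℕ) (hn : 1 ≤ n) (m : ℕ) (hm : 1 ≤ m)
    (u : SchwartzMap (EuclideanSpace ℝ (Fin n)) ℝ →L[ℝ] ℝ)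
    (hu : ∀ ψ χ : SchwartzMap (EuclideanSpace ℝ (Fin n)) ℝ,
      (∀ x, χ x = (-1 : ℝ) ^ m * (lapPt n)^[m] (fun y => ψ y) x) → u χ = 0) :
    ∃ p : MvPolynomial (Fin n) ℝ,
      ∀ ψ : SchwartzMap (EuclideanSpace ℝ (Fin n)) ℝ,
        u ψ = ∫ x : EuclideanSpace ℝ (Fin n),
          MvPolynomial.eval (fun i => x i) p * ψ x := by
  let T : 𝓢(EuclideanSpace ℝ (Fin n), ℂ) →L[ℝ] ℝ :=
    u ∘L SchwartzMap.postcompCLM Complex.reCLM ∘L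
      FourierTransform.fourierInvCLM ℝ 𝓢(EuclideanSpace ℝ (Fin n), ℂ)
  have hTa : ∀ f, T f = u (SchwartzMap.postcompCLM Complex.reCLM (𝓕⁻ f)) := fun f => rfl
  have hT : ∀ f g : 𝓢(EuclideanSpace ℝ (Fin n), ℂ),
      (∀ x, g x = ‖x‖ ^ (2 * m) • f x) → T g = 0 := fun f g hfg => by
    have h := hu (SchwartzMap.postcompCLM Complex.reCLM (𝓕⁻ f))
      ((-1 : ℝ) ^ m • SchwartzMap.postcompCLM Complex.reCLM
        (((-(2 * Real.pi) ^ 2) ^ m : ℝ) • 𝓕⁻ g)) fun x => by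
      rw [← SchwartzMap.laplacian_iterate_fourierInv m f g hfg,
        ← SchwartzMap.laplacian_iterate_postcompCLM, smul_apply, smul_eq_mul,
        ← lapPt_iterate_coe_schwartzMap]
    rw [map_smul, map_smul, map_smul, ← hTa] at h
    have hπ : (-(2 * Real.pi) ^ 2) ^ m ≠ 0 :=
      pow_ne_zero _ (neg_ne_zero.2 (pow_ne_zero _ Real.two_pi_pos.ne'))
    simpa [hπ, Real.pi_ne_zero] using h
  obtain ⟨N, hN⟩ := SchwartzMap.exists_order_of_norm_pow_smul_eq_zero m T hT
  let L : (Σ k : Fin (N + 1), Fin k → Fin n) → 𝓢(EuclideanSpace ℝ (Fin n), ℝ) →ₗ[ℝ] ℝ :=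
    fun J => polynomialIntegral n (∏ j, MvPolynomial.X (J.2 j))
  have hspan : u.toLinearMap ∈ Submodule.span ℝ (Set.range L) := by
    refine mem_span_of_iInf_ker_le_ker fun ψ hψ => ?_
    simp only [Submodule.mem_iInf, LinearMap.mem_ker] at hψ
    have h := hN (𝓕 (SchwartzMap.postcompCLM Complex.ofRealCLM ψ)) fun k hk =>
      ψ.iteratedFDeriv_fourier_ofReal_eq_zero k fun J => hψ ⟨⟨k, Nat.lt_succ_of_le hk⟩, J⟩
    rw [hTa, FourierTransform.fourierInv_fourier_eq] at h
    have hre : SchwartzMap.postcompCLM Complex.reCLM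
        (SchwartzMap.postcompCLM Complex.ofRealCLM ψ) = ψ := by ext x; simp
    rw [hre] at h
    exact h
  have hle : Submodule.span ℝ (Set.range L) ≤ LinearMap.range (polynomialIntegral n) :=
    Submodule.span_le.2 (Set.range_subset_iff.2 fun J => ⟨_, rfl⟩)
  obtain ⟨p, hp⟩ := hle hspan
  exact ⟨p, fun ψ => (LinearMap.congr_fun hp ψ).symm⟩
end
end
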